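/- There exists an absolute constant C > 0 such that for every odd prime p and every real x ≥ 2, the count N_■(p,x) of square-full primitive roots modulo p in [1,x] satisfies | N_■(p,x) − (φ(p−1)/(p−1)) · ζ(3)^{-1} · (1 + 1/p + 1/p²)^{-1} · C_p · x^{1/2} | ≤ C · (φ(p−1)/(p−1)) · x^{1/3} · (log x) · p^{1/9} · (log p)^{1/6} · 2^{ω(p−1)}, where C_p = 2 · ∑_{n ≥ 1, (n|p) = −1} n^{−3/2}, the sum being over positive integers n that are quadratic non-residues modulo p. -/

import Mathlib

/-- A positive integer `n` is square-full if every prime `q` dividing `n` satisfies `q^2 ∣ n`. -/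
def Squarefull (n : ℕ) : Prop := ∀ q : ℕ, q.Prime → q ∣ n → q ^ 2 ∣ n

namespace SquarefullPrimitiveRoots

section Stepanov

open Polynomial

variable {F : Type*} [Field F]

/-- The operator on polynomials with
`(f g)ᵗ · Dᵗ (r fᵃ gᵇ) = twistedDeriv f g a b t r · fᵃ gᵇ`. -/
noncomputable def twistedDeriv (f g : F[X]) (a b : ℕ) : ℕ → (F[X] →ₗ[F] F[X])
  | 0 => LinearMap.id
  | t + 1 =>
    (LinearMap.mulLeft F (f * g) ∘ₗ (derivative : F[X] →ₗ[F] F[X]) +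
      LinearMap.mulLeft F ((a : F[X]) * (derivative f * g) + (b : F[X]) * (f * derivative g)
        - (t : F[X]) * derivative (f * g))) ∘ₗ twistedDeriv f g a b t

lemma mul_derivative_pow (f : F[X]) (a : ℕ) :
    f * derivative (f ^ a) = (a : F[X]) * derivative f * f ^ a := by
  cases a with
  | zero => simp
  | succ n => rw [derivative_pow_succ]; push_cast; simp only [map_add, map_natCast, map_one]; ring

lemma twistedDeriv_spec (f g r : F[X]) (a b t : ℕ) :
    (f * g) ^ t * derivative^[t] (r * (f ^ a * g ^ b)) =
      twistedDeriv f g a b t r * (f ^ a * g ^ b) := by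
  induction t with
  | zero => simp [twistedDeriv]
  | succ t ih =>
    have h := congrArg (fun q => f * g * derivative q) ih
    simp only [derivative_mul] at h
    rw [Function.iterate_succ_apply']
    set w := derivative^[t] (r * (f ^ a * g ^ b))
    set v := twistedDeriv f g a b t r with hv
    have hf := mul_derivative_pow f a
    have hg := mul_derivative_pow g b
    have ht : f * g * derivative ((f * g) ^ t)
        = (t : F[X]) * derivative (f * g) * (f * g) ^ t := mul_derivative_pow (f * g) t
    have hw : twistedDeriv f g a b (t + 1) r = f * g * derivative v +
        ((a : F[X]) * (derivative f * g) + (b : F[X]) * (f * derivative g)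
        - (t : F[X]) * derivative (f * g)) * v := by
      simp [twistedDeriv, hv, mul_assoc]
    rw [hw]
    linear_combination h - ht * w + v * g * g ^ b * hf + v * f * f ^ a * hg
      - (t : F[X]) * derivative (f * g) * ih

lemma natDegree_twistedDeriv_le (f g r : F[X]) (hf : f.natDegree ≤ 3) (hg : g.natDegree ≤ 3)
    (a b t : ℕ) : (twistedDeriv f g a b t r).natDegree ≤ r.natDegree + 5 * t := by
  induction t with
  | zero => simp [twistedDeriv]
  | succ t ih =>
    set v := twistedDeriv f g a b t r with hv
    have hw : twistedDeriv f g a b (t + 1) r = f * g * derivative v +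
        ((a : F[X]) * (derivative f * g) + (b : F[X]) * (f * derivative g)
        - (t : F[X]) * derivative (f * g)) * v := by
      simp [twistedDeriv, hv, mul_assoc]
    have hf' : (derivative f).natDegree ≤ 2 := (natDegree_derivative_le f).trans (by omega)
    have hg' : (derivative g).natDegree ≤ 2 := (natDegree_derivative_le g).trans (by omega)
    have h1 : (f * g).natDegree ≤ 6 := natDegree_mul_le.trans (by omega)
    have h1' : (derivative (f * g)).natDegree ≤ 5 := (natDegree_derivative_le _).trans (by omega)
    have hc : ∀ n : ℕ, ∀ q : F[X], q.natDegree ≤ 5 → ((n : F[X]) * q).natDegree ≤ 5 := by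
      intro n q hq
      refine natDegree_mul_le.trans ?_
      simpa using hq
    rw [hw]
    refine natDegree_add_le_of_degree_le ?_ ?_
    · by_cases h0 : v.natDegree = 0
      · rw [natDegree_eq_zero.mp h0 |>.choose_spec.symm]; simp
      · have := natDegree_derivative_lt h0
        refine natDegree_mul_le.trans ?_
        omega
    · refine natDegree_mul_le.trans ?_
      have : ((a : F[X]) * (derivative f * g) + (b : F[X]) * (f * derivative g)
        - (t : F[X]) * derivative (f * g)).natDegree ≤ 5 := by
        refine (natDegree_sub_le_of_le (m := 5) (n := 5)
          (natDegree_add_le_of_degree_le ?_ ?_) ?_).trans (by simp)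
        · exact hc _ _ (natDegree_mul_le.trans (by omega))
        · exact hc _ _ (natDegree_mul_le.trans (by omega))
        · exact hc _ _ h1'
      omega

lemma iterate_derivative_X_pow_mul_of_charP (p : ℕ) [CharP F p] (j t : ℕ) (q : F[X]) :
    derivative^[t] (X ^ (p * j) * q) = X ^ (p * j) * derivative^[t] q := by
  induction t with
  | zero => rfl
  | succ t ih =>
    rw [Function.iterate_succ_apply', Function.iterate_succ_apply', ih, derivative_mul,
      derivative_X_pow]
    simp

lemma pow_dvd_of_iterate_derivative (p : ℕ) [hp : Fact p.Prime] [CharP F p] (q : F[X]) (x : F)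
    (l : ℕ) (hl : l ≤ p) (h : ∀ t < l, (derivative^[t] q).IsRoot x) : (X - C x) ^ l ∣ q := by
  rcases Nat.eq_zero_or_pos l with rfl | hl0
  · simp
  by_cases hq : q = 0
  · simp [hq]
  rw [← le_rootMultiplicity_iff hq]
  obtain ⟨m, rfl⟩ : ∃ m, l = m + 1 := ⟨l - 1, by omega⟩
  refine lt_rootMultiplicity_of_isRoot_iterate_derivative_of_mem_nonZeroDivisors hq
    (fun t ht => h t (by omega)) ?_
  rw [mem_nonZeroDivisors_iff_ne_zero]
  rw [Ne, CharP.cast_eq_zero_iff F p, hp.out.dvd_factorial]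
  omega

lemma prod_sub_pow_card_le_natDegree (q : F[X]) (hq : q ≠ 0) (Z : Finset F) (l : ℕ)
    (h : ∀ x ∈ Z, (X - C x) ^ l ∣ q) : l * Z.card ≤ q.natDegree := by
  have hd : ∏ x ∈ Z, (X - C x) ^ l ∣ q := by
    refine Finset.prod_dvd_of_coprime ?_ h
    intro x _ y _ hxy
    exact (isCoprime_X_sub_C_of_isUnit_sub (sub_ne_zero.mpr hxy).isUnit).pow
  have := natDegree_le_of_dvd hd hq
  rw [natDegree_prod_of_monic _ _ (fun x _ => (monic_X_sub_C x).pow l)] at this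
  simp only [natDegree_pow, natDegree_X_sub_C, Finset.sum_const, smul_eq_mul] at this
  nlinarith

/-- Monomials with distinct exponents, multiplied by polynomials that do not vanish at `0`, are
linearly independent. -/
lemma sum_monomial_mul_ne_zero {ι : Type*} [Fintype ι] (n : ι → ℕ) (hn : Function.Injective n)
    (U : ι → F[X]) (hU : ∀ i, (U i).coeff 0 ≠ 0) (c : ι → F) (hc : c ≠ 0) :
    ∑ i, c i • (X ^ n i * U i) ≠ 0 := by
  classical
  obtain ⟨i₁, hi₁⟩ := Function.ne_iff.mp hc
  obtain ⟨i₀, h0, hmin⟩ := Finset.exists_min_image (Finset.univ.filter fun i => c i ≠ 0) n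
    ⟨i₁, by simpa using hi₁⟩
  simp only [Finset.mem_filter, Finset.mem_univ, true_and] at h0 hmin
  intro h
  have h1 := congrArg (fun q => coeff q (n i₀)) h
  simp only [finsetSum_coeff, coeff_smul, smul_eq_mul, coeff_zero] at h1
  rw [Finset.sum_eq_single i₀] at h1
  · rw [coeff_X_pow_mul', if_pos le_rfl, Nat.sub_self] at h1
    exact (mul_ne_zero h0 (hU i₀)) h1
  · intro i _ hi
    by_cases hci : c i = 0
    · simp [hci]
    · have hlt : n i₀ < n i := lt_of_le_of_ne (hmin i hci) (fun h => hi (hn h.symm))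
      rw [coeff_X_pow_mul', if_neg (by omega), mul_zero]
  · simp

lemma exists_ne_zero_of_card_lt {ι κ : Type*} [Fintype ι] [Fintype κ]
    (h : Fintype.card κ < Fintype.card ι) (L : (ι → F) →ₗ[F] (κ → F)) :
    ∃ c, c ≠ 0 ∧ L c = 0 := by
  have h1 : LinearMap.ker L ≠ ⊥ := LinearMap.ker_ne_bot_of_finrank_lt (by simpa using h)
  obtain ⟨c, hc, hc0⟩ := (Submodule.ne_bot_iff _).mp h1
  exact ⟨c, hc0, hc⟩

/-- Stepanov's method: a bound for the number of solutions of `f(x)ᵏ = g(x)ᵏ ≠ 0` with `f` vanishing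
at `0` to order one and `g` not vanishing there. -/
lemma stepanov_bound (p : ℕ) [hp : Fact p.Prime] (f g h : (ZMod p)[X]) (hfh : f = X * h)
    (h0 : h.eval 0 ≠ 0) (g0 : g.eval 0 ≠ 0) (hf : f.natDegree ≤ 3) (hg : g.natDegree ≤ 3)
    (e k J l : ℕ) (hek : e * k = p - 1) (hl : l ≤ p) (hJ : l * (k + J + 5 * l) < e * (J * k))
    (Z : Finset (ZMod p))
    (hZ : ∀ x ∈ Z, f.eval x ^ k = g.eval x ^ k ∧ f.eval x ≠ 0 ∧ g.eval x ≠ 0) :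
    l * Z.card ≤ k + p * (J - 1) + 3 * (e * k) := by
  have hp1 := hp.out.one_lt
  let W : Fin e × Fin J × Fin k → (ZMod p)[X] := fun τ => f ^ (k * τ.1) * g ^ (k * (e - 1 - τ.1))
  let Q : ℕ → ((Fin e × Fin J × Fin k → ZMod p) →ₗ[ZMod p] (ZMod p)[X]) := fun t =>
    Fintype.linearCombination (ZMod p) (fun τ => X ^ (τ.2.1 : ℕ) *
      twistedDeriv f g (k * τ.1) (k * (e - 1 - τ.1)) t (X ^ (τ.2.2 : ℕ)))
  have hQdeg : ∀ t < l, ∀ c, (Q t c).natDegree < k + J + 5 * l := by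
    intro t ht c
    by_cases hk : k + J = 0
    · have hk0 : k = 0 := by omega
      subst hk0
      omega
    refine lt_of_le_of_lt (b := k + J + 5 * t - 1) ?_ (by omega)
    simp only [Q, Fintype.linearCombination_apply]
    refine natDegree_sum_le_of_forall_le _ _ (fun τ _ => ?_)
    refine (natDegree_smul_le _ _).trans (natDegree_mul_le.trans ?_)
    have h1 := natDegree_twistedDeriv_le f g (X ^ (τ.2.2 : ℕ)) hf hg (k * τ.1)
      (k * (e - 1 - τ.1)) t
    rw [natDegree_X_pow] at h1 ⊢
    have h2 := τ.2.1.2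
    have h3 := τ.2.2.2
    omega
  let L : (Fin e × Fin J × Fin k → ZMod p) →ₗ[ZMod p] (Fin l × Fin (k + J + 5 * l) → ZMod p) :=
    LinearMap.pi fun κ => lcoeff (ZMod p) κ.2 ∘ₗ Q κ.1
  obtain ⟨c, hc, hLc⟩ := exists_ne_zero_of_card_lt (by simpa using hJ) L
  have hQ0 : ∀ t < l, Q t c = 0 := by
    intro t ht
    ext n
    by_cases hn : n < k + J + 5 * l
    · exact congrFun hLc (⟨t, ht⟩, ⟨n, hn⟩)
    · rw [coeff_eq_zero_of_natDegree_lt ((hQdeg t ht c).trans_le (not_lt.mp hn)), coeff_zero]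
  let P : (ZMod p)[X] := ∑ τ, c τ • (X ^ (p * (τ.2.1 : ℕ)) * (X ^ (τ.2.2 : ℕ) * W τ))
  have hP0 : P ≠ 0 := by
    have hP : P = ∑ τ : Fin e × Fin J × Fin k, c τ • (X ^ (p * τ.2.1 + (k * τ.1 + τ.2.2)) *
        (h ^ (k * (τ.1 : ℕ)) * g ^ (k * (e - 1 - τ.1)))) := by
      refine Finset.sum_congr rfl fun τ _ => ?_
      simp only [W, hfh]
      congr 1
      rw [mul_pow]
      ring
    rw [hP]
    refine sum_monomial_mul_ne_zero _ ?_ _ ?_ c hc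
    · have hlt : ∀ τ : Fin e × Fin J × Fin k, k * (τ.1 : ℕ) + τ.2.2 < p := by
        intro τ
        have h1 : (τ.1 : ℕ) + 1 ≤ e := τ.1.2
        have h2 := τ.2.2.2
        have : k * ((τ.1 : ℕ) + 1) ≤ k * e := Nat.mul_le_mul_left k h1
        rw [mul_comm k e, hek] at this
        rw [mul_add] at this
        omega
      intro τ σ hτσ
      simp only at hτσ
      have hm := congrArg (· % p) hτσ
      have hd := congrArg (· / p) hτσ
      simp only [Nat.mul_add_mod, Nat.mod_eq_of_lt (hlt _)] at hm
      simp only [Nat.mul_add_div hp.out.pos, Nat.div_eq_of_lt (hlt _), add_zero] at hd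
      have hm' := congrArg (· % k) hm
      have hd' := congrArg (· / k) hm
      have hk : 0 < k := by have := τ.2.2.2; omega
      simp only [Nat.mul_add_mod, Nat.mod_eq_of_lt (Fin.is_lt _)] at hm'
      simp only [Nat.mul_add_div hk, Nat.div_eq_of_lt (Fin.is_lt _), add_zero] at hd'
      ext <;> assumption
    · intro τ
      rw [coeff_zero_eq_eval_zero]
      simp [h0, g0]
  have hPdeg : P.natDegree ≤ k + p * (J - 1) + 3 * (e * k) := by
    refine natDegree_sum_le_of_forall_le _ _ (fun τ _ => ?_)
    refine (natDegree_smul_le _ _).trans (natDegree_mul_le.trans ?_)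
    refine (Nat.add_le_add_left natDegree_mul_le _).trans ?_
    simp only [W]
    refine (Nat.add_le_add_left (Nat.add_le_add_left natDegree_mul_le _) _).trans ?_
    simp only [natDegree_X_pow]
    have h1 : (f ^ (k * (τ.1 : ℕ))).natDegree ≤ k * τ.1 * 3 :=
      natDegree_pow_le.trans (Nat.mul_le_mul_left _ hf)
    have h2 : (g ^ (k * (e - 1 - τ.1))).natDegree ≤ k * (e - 1 - τ.1) * 3 :=
      natDegree_pow_le.trans (Nat.mul_le_mul_left _ hg)
    have h3 : p * (τ.2.1 : ℕ) ≤ p * (J - 1) := Nat.mul_le_mul_left p (by omega)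
    have h4 : k * (τ.1 : ℕ) + k * (e - 1 - τ.1) ≤ e * k := by
      rw [← mul_add, mul_comm e k]
      exact Nat.mul_le_mul_left k (by omega)
    have h5 := τ.2.2.2
    linarith
  refine (prod_sub_pow_card_le_natDegree P hP0 Z l ?_).trans hPdeg
  intro x hx
  obtain ⟨hk, hfx, hgx⟩ := hZ x hx
  refine pow_dvd_of_iterate_derivative p P x l hl fun t ht => ?_
  have hW : ∀ τ, (W τ).eval x = (g.eval x ^ k) ^ (e - 1) := by
    intro τ
    have h1 := τ.1.2
    simp only [W, eval_mul, eval_pow, pow_mul, hk]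
    rw [← pow_add]
    congr 1
    omega
  have key : (f * g) ^ t * derivative^[t] P = ∑ τ, c τ • (X ^ (p * (τ.2.1 : ℕ)) *
      (twistedDeriv f g (k * τ.1) (k * (e - 1 - τ.1)) t (X ^ (τ.2.2 : ℕ)) * W τ)) := by
    simp only [P, iterate_derivative_sum, iterate_derivative_smul,
      iterate_derivative_X_pow_mul_of_charP, Finset.mul_sum]
    refine Finset.sum_congr rfl fun τ _ => ?_
    rw [← twistedDeriv_spec, mul_smul_comm]
    congr 1
    ring
  have hev := congrArg (eval x) key
  have hQx := congrArg (eval x) (hQ0 t ht)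
  simp only [Q, Fintype.linearCombination_apply, eval_finsetSum, eval_smul, eval_mul, eval_pow,
    eval_X, eval_zero, smul_eq_mul] at hQx
  simp only [eval_finsetSum, eval_smul, eval_mul, eval_pow, eval_X, hW, smul_eq_mul, pow_mul,
    ZMod.pow_card] at hev
  have hz : (eval x f * eval x g) ^ t * eval x (derivative^[t] P) = 0 := by
    rw [hev, ← zero_mul ((g.eval x ^ k) ^ (e - 1)), ← hQx, Finset.sum_mul]
    refine Finset.sum_congr rfl fun τ _ => ?_
    ring
  exact (mul_eq_zero.mp hz).resolve_left (pow_ne_zero _ (mul_ne_zero hfx hgx))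

/-- The number of `x` for which `∏ (x + bᵢ) / ∏ (x + cᵢ)` is a nonzero `e`-th power residue, when some
`bᵢ` is different from all the other shifts. -/
lemma card_pow_eq_pow_le (p : ℕ) [hp : Fact p.Prime] (e k : ℕ) (hek : e * k = p - 1)
    (b c : Fin 3 → ZMod p) (i₀ : Fin 3) (hb : ∀ i, i ≠ i₀ → b i ≠ b i₀) (hc : ∀ i, c i ≠ b i₀) :
    (((Finset.univ : Finset (ZMod p)).filter fun x =>
      (∏ i, (x + b i)) ^ k = (∏ i, (x + c i)) ^ k ∧ ∏ i, (x + b i) ≠ 0 ∧ ∏ i, (x + c i) ≠ 0).card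
        : ℝ) ≤ (p : ℝ) / e + 40 * √(p : ℝ) := by
  have hp1 := hp.out.one_lt
  set Z := (Finset.univ : Finset (ZMod p)).filter fun x =>
      (∏ i, (x + b i)) ^ k = (∏ i, (x + c i)) ^ k ∧ ∏ i, (x + b i) ≠ 0 ∧ ∏ i, (x + c i) ≠ 0 with hZ
  have he : 0 < e := Nat.pos_of_ne_zero (by rintro rfl; omega)
  have hk : 0 < k := Nat.pos_of_ne_zero (by rintro rfl; omega)
  have hsq : √(p : ℝ) ^ 2 = p := Real.sq_sqrt (by positivity)
  have hs0 : 0 < √(p : ℝ) := Real.sqrt_pos.mpr (by positivity)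
  have hpe : (0 : ℝ) ≤ (p : ℝ) / e := by positivity
  set l := Nat.sqrt p / 4 with hl
  rcases Nat.eq_zero_or_pos l with hl0 | hl0
  · have h1 : Nat.sqrt p < 4 := by omega
    have h2 : p < 16 := Nat.sqrt_lt.mp h1
    have h3 : Z.card ≤ p := (Finset.card_le_univ _).trans (by rw [ZMod.card])
    have h4 : (Z.card : ℝ) ≤ p := by exact_mod_cast h3
    have h5 : (p : ℝ) ≤ 16 := by exact_mod_cast h2.le
    nlinarith
  have hs : (4 * l) * (4 * l) ≤ p := by
    refine le_trans ?_ (Nat.sqrt_le p)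
    have : 4 * l ≤ Nat.sqrt p := Nat.mul_div_le _ _
    exact Nat.mul_le_mul this this
  have hs' : √(p : ℝ) ≤ 8 * l := by
    have h1 : p < (Nat.sqrt p + 1) * (Nat.sqrt p + 1) := Nat.lt_succ_sqrt p
    have h2 : Nat.sqrt p + 1 ≤ 8 * l := by omega
    have h3 : p ≤ (8 * l) * (8 * l) := h1.le.trans (Nat.mul_le_mul h2 h2)
    rw [Real.sqrt_le_left (by positivity)]
    rw [sq]
    exact_mod_cast h3
  set J := l / e + 2 with hJ
  have hJ1 : l + 1 + e ≤ e * J := by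
    have := Nat.lt_mul_div_succ l he
    rw [hJ, show e * (l / e + 2) = e * (l / e + 1) + e by ring]
    omega
  have hJ2 : J ≤ l + 2 := by
    have := Nat.div_le_self l e
    omega
  set d := b i₀ with hd
  have hcond : l * (k + J + 5 * l) < e * (J * k) := by
    have h1 : (l + 1 + e) * k ≤ e * J * k := Nat.mul_le_mul_right k hJ1
    have h2 : l * J ≤ l * (l + 2) := Nat.mul_le_mul_left l hJ2
    have h3 : p ≤ e * k + 1 := by omega
    nlinarith
  have hdeg : ∀ b : Fin 3 → ZMod p, (∏ i, (X + C (b i - d))).natDegree ≤ 3 := by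
    intro b
    rw [natDegree_prod_of_monic _ _ (fun i _ => monic_X_add_C _)]
    simp only [natDegree_X_add_C]
    simp
  have hbound := stepanov_bound p (∏ i, (X + C (b i - d))) (∏ i, (X + C (c i - d)))
    (∏ i ∈ Finset.univ.erase i₀, (X + C (b i - d)))
    (by rw [← Finset.mul_prod_erase _ _ (Finset.mem_univ i₀), hd]; simp)
    (by
      rw [eval_prod]
      refine Finset.prod_ne_zero_iff.mpr fun i hi => ?_
      simpa [sub_eq_zero] using hb i (Finset.ne_of_mem_erase hi))
    (by
      rw [eval_prod]
      refine Finset.prod_ne_zero_iff.mpr fun i _ => ?_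
      simpa [sub_eq_zero] using hc i)
    (hdeg b) (hdeg c) e k J l hek (by nlinarith) hcond (Z.image (· + d)) (by
      intro y hy
      obtain ⟨x, hx, rfl⟩ := Finset.mem_image.mp hy
      have h1 : ∀ b : Fin 3 → ZMod p, eval (x + d) (∏ i, (X + C (b i - d))) = ∏ i, (x + b i) := by
        intro b
        rw [eval_prod]
        refine Finset.prod_congr rfl fun i _ => ?_
        simp
      rw [h1, h1]
      exact (Finset.mem_filter.mp hx).2)
  rw [Finset.card_image_of_injective _ (add_left_injective d), hek] at hbound
  have hlpos : (0 : ℝ) < l := by exact_mod_cast hl0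
  have hepos : (0 : ℝ) < e := by exact_mod_cast he
  have hb1 : (l : ℝ) * Z.card ≤ k + p * ((l / e : ℕ) + 1 : ℝ) + 3 * p := by
    have : l * Z.card ≤ k + p * (l / e + 1) + 3 * p := by
      rw [hJ] at hbound
      refine hbound.trans ?_
      have h1 : ∀ m : ℕ, m + 2 - 1 = m + 1 := fun m => rfl
      have h2 : 3 * (p - 1) ≤ 3 * p := by omega
      rw [h1]
      linarith
    exact_mod_cast this
  have hb2 : ((l / e : ℕ) : ℝ) ≤ (l : ℝ) / e := Nat.cast_div_le
  have hkp : (k : ℝ) ≤ p := by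
    have : k ≤ e * k := Nat.le_mul_of_pos_left k he
    exact_mod_cast (by omega : k ≤ p)
  have hb3 : (l : ℝ) * Z.card ≤ l * ((p : ℝ) / e) + 5 * p := by
    have h1 : (p : ℝ) * ((l / e : ℕ) + 1 : ℝ) ≤ p * ((l : ℝ) / e + 1) := by gcongr
    have h2 : (p : ℝ) * ((l : ℝ) / e + 1) = l * ((p : ℝ) / e) + p := by ring
    linarith
  have hb4 : 5 * (p : ℝ) ≤ l * (40 * √(p : ℝ)) := by nlinarith
  have hb5 : (l : ℝ) * Z.card ≤ l * ((p : ℝ) / e + 40 * √(p : ℝ)) := by linarith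
  exact le_of_mul_le_mul_left hb5 hlpos

end Stepanov

section Characters

variable {p : ℕ} [hp : Fact p.Prime]

lemma units_pow_eq_one_iff (e k : ℕ) (hek : e * k = p - 1) (u : (ZMod p)ˣ) :
    u ^ k = 1 ↔ ∃ v : (ZMod p)ˣ, v ^ e = u := by
  have hcard : Nat.card (ZMod p)ˣ = e * k := by
    rw [Nat.card_eq_fintype_card, ZMod.card_units, hek]
  constructor
  · intro h
    obtain ⟨g, hg⟩ := IsCyclic.exists_ofOrder_eq_natCard (α := (ZMod p)ˣ)
    obtain ⟨m, rfl⟩ : ∃ m : ℕ, g ^ m = u := by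
      have hmem : u ∈ Submonoid.powers g := by
        rw [mem_powers_iff_mem_zpowers]
        have htop : Subgroup.zpowers g = ⊤ :=
          Subgroup.eq_top_of_card_eq _ (by rw [Nat.card_zpowers, hg])
        rw [htop]; trivial
      exact hmem
    rw [← pow_mul, ← orderOf_dvd_iff_pow_eq_one, hg, hcard] at h
    have hk : 0 < k := Nat.pos_of_ne_zero (by
      rintro rfl
      have := hp.out.one_lt
      omega)
    obtain ⟨n, rfl⟩ := Nat.dvd_of_mul_dvd_mul_right hk h
    exact ⟨g ^ n, by rw [← pow_mul, mul_comm]⟩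
  · rintro ⟨v, rfl⟩
    rw [← pow_mul, ← hcard, pow_card_eq_one']

lemma dirichletCharacter_pow_card (χ : DirichletCharacter ℂ p) : χ ^ (p - 1) = 1 := by
  have := MulChar.pow_card_eq_one χ
  rwa [ZMod.card_units] at this

lemma isCyclic_dirichletCharacter : IsCyclic (DirichletCharacter ℂ p) := by
  obtain ⟨f⟩ := DirichletCharacter.mulEquiv_units ℂ p
  exact isCyclic_of_surjective f.symm f.symm.surjective

open Classical in
lemma card_pow_eq_one (e k : ℕ) (hek : e * k = p - 1) :
    (Finset.univ.filter fun χ : DirichletCharacter ℂ p => χ ^ e = 1).card = e := by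
  have hp1 := hp.out.one_lt
  have he : 0 < e := Nat.pos_of_ne_zero (by rintro rfl; omega)
  have hk : 0 < k := Nat.pos_of_ne_zero (by rintro rfl; omega)
  have := isCyclic_dirichletCharacter (p := p)
  refine le_antisymm (IsCyclic.card_pow_eq_one_le he) ?_
  obtain ⟨g, hg⟩ := IsCyclic.exists_ofOrder_eq_natCard (α := DirichletCharacter ℂ p)
  rw [DirichletCharacter.card_eq_totient_of_hasEnoughRootsOfUnity, Nat.totient_prime hp.out,
    ← hek] at hg
  have ho : orderOf (g ^ k) = e := by
    rw [orderOf_pow, hg, Nat.gcd_eq_right (Dvd.intro_left e rfl), Nat.mul_div_cancel _ hk]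
  calc e = (Finset.univ.filter fun χ => χ ∈ Subgroup.zpowers (g ^ k)).card := by
        rw [← ho, ← Nat.card_zpowers, Nat.card_eq_fintype_card, Fintype.card_subtype]
    _ ≤ _ := by
        refine Finset.card_le_card fun χ hχ => ?_
        simp only [Finset.mem_filter, Finset.mem_univ, true_and] at hχ ⊢
        obtain ⟨n, rfl⟩ := hχ
        simp only
        rw [← zpow_natCast, zpow_comm, zpow_natCast, ← pow_mul, mul_comm k e, hek,
          dirichletCharacter_pow_card, one_zpow]

open Classical in
/-- Orthogonality for the characters of order dividing `e`. -/
lemma sum_pow_eq_one_apply (e k : ℕ) (hek : e * k = p - 1) (u : ZMod p) (hu : u ≠ 0) :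
    ∑ χ : DirichletCharacter ℂ p with χ ^ e = 1, χ u = if u ^ k = 1 then (e : ℂ) else 0 := by
  split_ifs with h
  · have h1 : ∀ χ ∈ Finset.univ.filter fun χ : DirichletCharacter ℂ p => χ ^ e = 1, χ u = 1 := by
      intro χ hχ
      obtain ⟨v, hv⟩ := (units_pow_eq_one_iff e k hek (Units.mk0 u hu)).mp (by
        ext; simpa using h)
      have hv' : (v : ZMod p) ^ e = u := by simpa using congrArg Units.val hv
      have he : e ≠ 0 := by
        rintro rfl
        have := hp.out.one_lt
        omega
      rw [← hv', map_pow, ← MulChar.pow_apply' χ he, (Finset.mem_filter.mp hχ).2,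
        MulChar.one_apply v.isUnit]
    rw [Finset.sum_congr rfl h1]
    simp [card_pow_eq_one e k hek]
  · obtain ⟨χ, hχ⟩ := DirichletCharacter.exists_apply_ne_one_of_hasEnoughRootsOfUnity ℂ h
    have hk : k ≠ 0 := by
      rintro rfl
      have := hp.out.one_lt
      omega
    rw [map_pow, ← MulChar.pow_apply' χ hk] at hχ
    refine eq_zero_of_mul_eq_self_left hχ ?_
    rw [Finset.mul_sum]
    refine Finset.sum_bij' (fun ψ _ => χ ^ k * ψ) (fun ψ _ => (χ ^ k)⁻¹ * ψ) ?_ ?_ ?_ ?_ ?_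
    · intro ψ hψ
      simp only [Finset.mem_filter, Finset.mem_univ, true_and] at hψ ⊢
      rw [mul_pow, hψ, ← pow_mul, mul_comm k e, hek, dirichletCharacter_pow_card, one_mul]
    · intro ψ hψ
      simp only [Finset.mem_filter, Finset.mem_univ, true_and] at hψ ⊢
      rw [mul_pow, hψ, inv_pow, ← pow_mul, mul_comm k e, hek, dirichletCharacter_pow_card,
        inv_one, one_mul]
    · intro ψ _; simp
    · intro ψ _; simp
    · intro ψ _; simp

lemma norm_sum_pow_six (χ : DirichletCharacter ℂ p) (B : ℕ) (x : ZMod p) :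
    ((‖∑ b : Fin B, χ (x + (b : ℕ))‖ ^ 6 : ℝ) : ℂ) = ∑ t : (Fin 3 → Fin B) × (Fin 3 → Fin B),
      χ ((∏ i, (x + (t.1 i : ℕ))) * (∏ i, (x + (t.2 i : ℕ)))⁻¹) := by
  have h1 : ∀ z : ℂ, ((‖z‖ ^ 6 : ℝ) : ℂ) = z ^ 3 * (star z) ^ 3 := by
    intro z
    have := Complex.mul_conj' z
    push_cast
    rw [← mul_pow, RCLike.star_def, this]
    ring
  rw [h1, star_sum]
  simp only [MulChar.star_apply', MulChar.inv_apply']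
  rw [Fintype.sum_pow, Fintype.sum_pow, Finset.sum_mul_sum, Fintype.sum_prod_type]
  refine Finset.sum_congr rfl fun b _ => Finset.sum_congr rfl fun c _ => ?_
  rw [map_mul, map_prod, ← Finset.prod_inv_distrib, map_prod]

lemma card_pairs_le {α : Type*} [Fintype α] [DecidableEq α] :
    (Finset.univ.filter fun t : (Fin 3 → α) × (Fin 3 → α) =>
      ∀ i, ∃ j, j ≠ i ∧ Sum.elim t.1 t.2 j = Sum.elim t.1 t.2 i).card
        ≤ 729 * Fintype.card α ^ 3 := by
  classical
  rcases isEmpty_or_nonempty α with hα | hα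
  · rw [Finset.univ_eq_empty]; simp
  let Ψ : (Fin 3 ⊕ Fin 3 → Fin 3) × (Fin 3 → α) → (Fin 3 → α) × (Fin 3 → α) :=
    fun s => (fun i => s.2 (s.1 (Sum.inl i)), fun i => s.2 (s.1 (Sum.inr i)))
  calc _ ≤ (Finset.univ.image Ψ).card := by
        refine Finset.card_le_card fun t ht => ?_
        simp only [Finset.mem_filter, Finset.mem_univ, true_and] at ht
        set T := Sum.elim t.1 t.2 with hT
        have himg : 2 * (Finset.univ.image T).card ≤ (Finset.univ : Finset (Fin 3 ⊕ Fin 3)).card := by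
          refine Finset.mul_card_image_le_card _ _ ?_
          intro a ha
          obtain ⟨i, -, rfl⟩ := Finset.mem_image.mp ha
          obtain ⟨j, hji, hj⟩ := ht i
          refine (Finset.one_lt_card.mpr ⟨j, ?_, i, ?_, hji⟩)
          · simp [hj]
          · simp
        have h3 : (Finset.univ.image T).card ≤ 3 := by
          simp at himg
          omega
        obtain ⟨f⟩ : Nonempty ((Finset.univ.image T : Finset α) ↪ Fin 3) :=
          Function.Embedding.nonempty_of_card_le (by
            rw [Fintype.card_coe, Fintype.card_fin]; exact h3)
        let h : Fin 3 ⊕ Fin 3 → Fin 3 := fun i => f ⟨T i, by simp⟩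
        let g : Fin 3 → α := fun n => if hn : ∃ a, f a = n then (hn.choose : α)
          else Classical.arbitrary α
        have hgh : ∀ i, g (h i) = T i := by
          intro i
          have hn : ∃ a, f a = h i := ⟨_, rfl⟩
          simp only [g, dif_pos hn]
          have := f.injective hn.choose_spec
          rw [this]
        refine Finset.mem_image.mpr ⟨(h, g), Finset.mem_univ _, ?_⟩
        ext i
        · simp [Ψ, hgh, hT]
        · simp [Ψ, hgh, hT]
    _ ≤ _ := Finset.card_image_le
    _ = _ := by simp

open Classical in
/-- Sixth moment of short character sums, averaged over the nontrivial characters of order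
dividing `e`. -/
lemma sixth_moment_le (e k : ℕ) (hek : e * k = p - 1) (B : ℕ) (hB : B ≤ p) :
    ∑ χ : DirichletCharacter ℂ p with χ ^ e = 1 ∧ χ ≠ 1,
      ∑ x : ZMod p, ‖∑ b : Fin B, χ (x + (b : ℕ))‖ ^ 6 ≤
        e * (729 * B ^ 3 * p + 46 * B ^ 6 * √(p : ℝ)) := by
  have hp1 := hp.out.one_lt
  have he : 0 < e := Nat.pos_of_ne_zero (by rintro rfl; omega)
  have hk : 0 < k := Nat.pos_of_ne_zero (by rintro rfl; omega)
  have he0 : (0 : ℝ) < e := by exact_mod_cast he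
  have hs1 : 1 ≤ √(p : ℝ) := Real.one_le_sqrt.mpr (by exact_mod_cast hp1.le)
  let R : (Fin 3 → Fin B) × (Fin 3 → Fin B) → ZMod p → ZMod p := fun t x =>
    (∏ i, (x + (t.1 i : ℕ))) * (∏ i, (x + (t.2 i : ℕ)))⁻¹
  let N₁ := fun t => (Finset.univ.filter fun x => R t x ≠ 0 ∧ R t x ^ k = 1).card
  let N₀ := fun t => (Finset.univ.filter fun x => R t x ≠ 0).card
  have hexp : ∑ χ : DirichletCharacter ℂ p with χ ^ e = 1 ∧ χ ≠ 1,
      ∑ x : ZMod p, ‖∑ b : Fin B, χ (x + (b : ℕ))‖ ^ 6 =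
        ∑ t, ((e : ℝ) * N₁ t - N₀ t) := by
    have hsplit : (Finset.univ.filter fun χ : DirichletCharacter ℂ p => χ ^ e = 1 ∧ χ ≠ 1) =
        (Finset.univ.filter fun χ : DirichletCharacter ℂ p => χ ^ e = 1).erase 1 := by
      ext χ; simp [and_comm]
    apply Complex.ofReal_injective
    rw [hsplit]
    push_cast [norm_sum_pow_six]
    have hpt : ∀ t x, ∑ χ ∈ (Finset.univ.filter fun χ : DirichletCharacter ℂ p => χ ^ e = 1).erase 1,
        χ (R t x) = (e : ℂ) * (if R t x ≠ 0 ∧ R t x ^ k = 1 then 1 else 0) -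
          (if R t x ≠ 0 then 1 else 0) := by
      intro t x
      by_cases h : R t x = 0
      · rw [h]
        simp [MulChar.map_zero]
      · rw [Finset.sum_erase_eq_sub (by simp), sum_pow_eq_one_apply e k hek _ h,
          MulChar.one_apply (Ne.isUnit h)]
        simp [h]
    calc _ = ∑ χ ∈ (Finset.univ.filter fun χ : DirichletCharacter ℂ p => χ ^ e = 1).erase 1,
          ∑ x, ∑ t, χ (R t x) := by
          refine Finset.sum_congr rfl fun χ _ => Finset.sum_congr rfl fun x _ => ?_
          have := norm_sum_pow_six χ B x
          push_cast at this
          exact this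
      _ = ∑ t, ∑ x, ∑ χ ∈ (Finset.univ.filter fun χ : DirichletCharacter ℂ p => χ ^ e = 1).erase 1,
          χ (R t x) := by
          rw [Finset.sum_congr rfl fun χ _ => Finset.sum_comm, Finset.sum_comm]
          exact Finset.sum_congr rfl fun t _ => Finset.sum_comm
      _ = _ := by
          refine Finset.sum_congr rfl fun t _ => ?_
          simp only [hpt, Finset.sum_sub_distrib, ← Finset.mul_sum, Finset.sum_boole, N₁, N₀]
  rw [hexp]
  have hN₁p : ∀ t, (N₁ t : ℝ) ≤ p := by
    intro t
    have : N₁ t ≤ Fintype.card (ZMod p) := Finset.card_le_univ _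
    rw [ZMod.card] at this
    exact_mod_cast this
  have hN₀ : ∀ t, (p : ℝ) - 6 ≤ N₀ t := by
    intro t
    have h1 : N₀ t + (Finset.univ.filter fun x => ¬ (R t x ≠ 0)).card = p := by
      have := Finset.card_filter_add_card_filter_not (s := (Finset.univ : Finset (ZMod p)))
        (fun x => R t x ≠ 0)
      rwa [Finset.card_univ, ZMod.card] at this
    have h2 : (Finset.univ.filter fun x => ¬ (R t x ≠ 0)).card ≤ 6 := by
      calc _ ≤ (Finset.univ.image fun j : Fin 3 ⊕ Fin 3 =>
              -(((Sum.elim t.1 t.2 j : Fin B) : ℕ) : ZMod p)).card := by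
            refine Finset.card_le_card fun x hx => ?_
            have hx' : R t x = 0 := by simpa using hx
            simp only [R, mul_eq_zero, inv_eq_zero, Finset.prod_eq_zero_iff] at hx'
            rcases hx' with ⟨i, -, hi⟩ | ⟨i, -, hi⟩
            · exact Finset.mem_image.mpr ⟨Sum.inl i, Finset.mem_univ _, by
                simpa using (eq_neg_of_add_eq_zero_left hi).symm⟩
            · exact Finset.mem_image.mpr ⟨Sum.inr i, Finset.mem_univ _, by
                simpa using (eq_neg_of_add_eq_zero_left hi).symm⟩
        _ ≤ _ := Finset.card_image_le
        _ = 6 := by simp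
    have h3 : p ≤ N₀ t + 6 := by omega
    have h4 : (p : ℝ) ≤ N₀ t + 6 := by exact_mod_cast h3
    linarith
  have hinj : ∀ a b : Fin B, a ≠ b → ((a : ℕ) : ZMod p) ≠ ((b : ℕ) : ZMod p) := by
    intro a b hab h
    rw [ZMod.natCast_eq_natCast_iff'] at h
    rw [Nat.mod_eq_of_lt (a.2.trans_le hB), Nat.mod_eq_of_lt (b.2.trans_le hB)] at h
    exact hab (Fin.ext h)
  have hN₁ : ∀ t, ¬ (∀ i, ∃ j, j ≠ i ∧ Sum.elim t.1 t.2 j = Sum.elim t.1 t.2 i) →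
      (N₁ t : ℝ) ≤ (p : ℝ) / e + 40 * √(p : ℝ) := by
    intro t ht
    push Not at ht
    obtain ⟨i | i, hi⟩ := ht
    · refine le_trans ?_ (card_pow_eq_pow_le p e k hek (fun i => ((t.1 i : ℕ) : ZMod p))
        (fun i => ((t.2 i : ℕ) : ZMod p)) i ?_ ?_)
      · norm_cast
        refine Finset.card_le_card fun x hx => ?_
        simp only [Finset.mem_filter, Finset.mem_univ, true_and, R, mul_ne_zero_iff]
          at hx ⊢
        obtain ⟨⟨h1, h2⟩, h3⟩ := hx
        rw [ne_eq, inv_eq_zero] at h2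
        refine ⟨?_, h1, h2⟩
        rw [mul_pow, inv_pow] at h3
        exact (mul_inv_eq_one₀ (pow_ne_zero _ h2)).mp h3
      · intro j hj
        exact hinj _ _ (hi (Sum.inl j) (by simpa using hj))
      · intro j
        exact hinj _ _ (hi (Sum.inr j) (by simp))
    · refine le_trans ?_ (card_pow_eq_pow_le p e k hek (fun i => ((t.2 i : ℕ) : ZMod p))
        (fun i => ((t.1 i : ℕ) : ZMod p)) i ?_ ?_)
      · norm_cast
        refine Finset.card_le_card fun x hx => ?_
        simp only [Finset.mem_filter, Finset.mem_univ, true_and, R, mul_ne_zero_iff]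
          at hx ⊢
        obtain ⟨⟨h1, h2⟩, h3⟩ := hx
        rw [ne_eq, inv_eq_zero] at h2
        refine ⟨?_, h2, h1⟩
        rw [mul_pow, inv_pow] at h3
        exact ((mul_inv_eq_one₀ (pow_ne_zero _ h2)).mp h3).symm
      · intro j hj
        exact hinj _ _ (hi (Sum.inr j) (by simpa using hj))
      · intro j
        exact hinj _ _ (hi (Sum.inl j) (by simp))
  let P : (Fin 3 → Fin B) × (Fin 3 → Fin B) → Prop := fun t =>
    ∀ i, ∃ j, j ≠ i ∧ Sum.elim t.1 t.2 j = Sum.elim t.1 t.2 i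
  have hterm : ∀ t, (e : ℝ) * N₁ t - N₀ t ≤
      (if P t then (e : ℝ) * p else 0) + 46 * e * √(p : ℝ) := by
    intro t
    have he1 : (1 : ℝ) ≤ e := by exact_mod_cast he
    have hes : 1 ≤ e * √(p : ℝ) := by nlinarith
    split_ifs with h
    · have := mul_le_mul_of_nonneg_left (hN₁p t) he0.le
      have h0 : (0 : ℝ) ≤ N₀ t := Nat.cast_nonneg _
      nlinarith
    · have h1 := mul_le_mul_of_nonneg_left (hN₁ t h) he0.le
      have h2 : (e : ℝ) * ((p : ℝ) / e + 40 * √(p : ℝ)) = p + 40 * (e * √(p : ℝ)) := by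
        field_simp
      have h3 := hN₀ t
      nlinarith
  have hcard : (Finset.univ.filter P).card ≤ 729 * B ^ 3 := by
    have := card_pairs_le (α := Fin B)
    rw [Fintype.card_fin] at this
    convert this
  have hcard' : ((Finset.univ.filter P).card : ℝ) ≤ 729 * B ^ 3 := by exact_mod_cast hcard
  have hU : Fintype.card ((Fin 3 → Fin B) × (Fin 3 → Fin B)) = B ^ 6 := by
    simp only [Fintype.card_prod, Fintype.card_fun, Fintype.card_fin]
    ring
  calc ∑ t, ((e : ℝ) * N₁ t - N₀ t) ≤ ∑ t, ((if P t then (e : ℝ) * p else 0) + 46 * e * √(p : ℝ)) :=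
        Finset.sum_le_sum fun t _ => hterm t
    _ = (Finset.univ.filter P).card * (e * p) + B ^ 6 * (46 * e * √(p : ℝ)) := by
        rw [Finset.sum_add_distrib, ← Finset.sum_filter, Finset.sum_const, Finset.sum_const,
          Finset.card_univ, hU]
        simp
    _ ≤ (729 * B ^ 3) * (e * p) + B ^ 6 * (46 * e * √(p : ℝ)) := by
        gcongr
    _ = _ := by ring

end Characters

section Counting

lemma card_congruence_le {p : ℕ} (A N M a b : ℕ) (ha : 0 < a) (haA : a ≤ A) (hb : 0 < b)
    (hbA : b ≤ A) (hp : A * N ≤ p) :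
    ((Finset.range N ×ˢ Finset.range N).filter fun q : ℕ × ℕ =>
      (b : ZMod p) * ((M + q.1 : ℕ) : ZMod p) = a * ((M + q.2 : ℕ) : ZMod p)).card
        ≤ 2 * (N / (a / a.gcd b) + 1) := by
  set g := a.gcd b with hg
  have hg0 : 0 < g := Nat.gcd_pos_of_pos_left _ ha
  have hag : 0 < a / g := Nat.div_pos (Nat.gcd_le_left _ ha) hg0
  calc _ ≤ ((Finset.univ : Finset Bool) ×ˢ Finset.range (N / (a / g) + 1)).card := by
        refine Finset.card_le_card_of_injOn
          (fun q => (decide (a * q.2 ≤ b * q.1), q.1 / (a / g))) ?_ ?_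
        · intro q hq
          simp only [Finset.coe_filter, Finset.mem_product, Finset.mem_range, Set.mem_ofPred_eq]
            at hq
          simp only [Finset.coe_product, Finset.coe_univ, Finset.coe_range, Set.mem_prod,
            Set.mem_univ, true_and, Set.mem_Iio]
          exact Nat.lt_succ_of_le (Nat.div_le_div_right hq.1.1.le)
        · rintro ⟨n₁, n₂⟩ h ⟨m₁, m₂⟩ h' heq
          simp only [Finset.coe_filter, Finset.mem_product, Finset.mem_range, Set.mem_ofPred_eq]
            at h h'
          simp only [Prod.mk.injEq, decide_eq_decide] at heq
          obtain ⟨⟨hn₁, hn₂⟩, hn⟩ := h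
          obtain ⟨⟨hm₁, hm₂⟩, hm⟩ := h'
          obtain ⟨hsgn, hquo⟩ := heq
          have hlt : ∀ c n : ℕ, 0 < c → c ≤ A → n < N → c * n < p := fun c n hc hcA hnN =>
            (Nat.mul_lt_mul_of_le_of_lt hcA hnN (hc.trans_le hcA)).trans_le hp
          have e1 := hlt a n₂ ha haA hn₂
          have e2 := hlt b n₁ hb hbA hn₁
          have e3 := hlt a m₂ ha haA hm₂
          have e4 := hlt b m₁ hb hbA hm₁
          have hdvd : (p : ℤ) ∣ (b * n₁ - a * n₂) - (b * m₁ - a * m₂) := by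
            rw [← ZMod.intCast_zmod_eq_zero_iff_dvd]
            push_cast at hn hm ⊢
            linear_combination hn - hm
          have hv : (b * n₁ - a * n₂ : ℤ) - (b * m₁ - a * m₂) = 0 := by
            refine Int.eq_zero_of_abs_lt_dvd hdvd ?_
            zify at e1 e2 e3 e4 hsgn
            have p1 : (0 : ℤ) ≤ a * n₂ := by positivity
            have p2 : (0 : ℤ) ≤ b * n₁ := by positivity
            have p3 : (0 : ℤ) ≤ a * m₂ := by positivity
            have p4 : (0 : ℤ) ≤ b * m₁ := by positivity
            rw [abs_lt]
            by_cases hs : (a : ℤ) * n₂ ≤ b * n₁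
            · have := hsgn.mp hs
              constructor <;> linarith
            · have := mt hsgn.mpr hs
              constructor <;> linarith
          have hmod : n₁ ≡ m₁ [MOD a / g] := by
            have h1 : b * n₁ ≡ b * m₁ [MOD a] := by
              rw [Nat.modEq_iff_dvd]
              refine ⟨(m₂ : ℤ) - n₂, ?_⟩
              push_cast
              linarith
            have := Nat.ModEq.cancel_left_div_gcd ha h1
            exact this
          have hn1 : n₁ = m₁ := by
            rw [← Nat.div_add_mod n₁ (a / g), ← Nat.div_add_mod m₁ (a / g), hquo, hmod]
          subst hn1
          have : (a : ℤ) * n₂ = a * m₂ := by linarith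
          have : n₂ = m₂ := by
            have ha' : (a : ℤ) ≠ 0 := by exact_mod_cast ha.ne'
            exact_mod_cast mul_left_cancel₀ ha' this
          rw [this]
    _ = _ := by simp

lemma sum_gcd_div_le (A : ℕ) :
    ∑ a ∈ Finset.Ioc 0 A, ∑ b ∈ Finset.Ioc 0 a, ((a.gcd b : ℕ) : ℝ) / a ≤
      A * (1 + Real.log A) := by
  have hcard : ∀ n d : ℕ, ((Finset.Ioc 0 n).filter (d ∣ ·)).card = n / d :=
    fun n d => Nat.Ioc_filter_dvd_card_eq_div n d
  calc ∑ a ∈ Finset.Ioc 0 A, ∑ b ∈ Finset.Ioc 0 a, ((a.gcd b : ℕ) : ℝ) / a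
      ≤ ∑ a ∈ Finset.Ioc 0 A, ∑ b ∈ Finset.Ioc 0 a, ∑ d ∈ Finset.Ioc 0 A,
          if d ∣ a ∧ d ∣ b then (d : ℝ) / a else 0 := by
        refine Finset.sum_le_sum fun a ha => Finset.sum_le_sum fun b _ => ?_
        rw [Finset.mem_Ioc] at ha
        have hmem : a.gcd b ∈ Finset.Ioc 0 A := Finset.mem_Ioc.mpr
          ⟨Nat.gcd_pos_of_pos_left _ ha.1, (Nat.gcd_le_left _ ha.1).trans ha.2⟩
        have := Finset.single_le_sum (f := fun d : ℕ =>
          if d ∣ a ∧ d ∣ b then (d : ℝ) / a else 0) (fun d _ => by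
            split_ifs <;> positivity) hmem
        simpa [Nat.gcd_dvd_left, Nat.gcd_dvd_right] using this
    _ = ∑ a ∈ Finset.Ioc 0 A, ∑ d ∈ Finset.Ioc 0 A, ∑ b ∈ Finset.Ioc 0 a,
          if d ∣ a ∧ d ∣ b then (d : ℝ) / a else 0 :=
        Finset.sum_congr rfl fun a _ => Finset.sum_comm
    _ ≤ ∑ a ∈ Finset.Ioc 0 A, ∑ d ∈ Finset.Ioc 0 A, if d ∣ a then (1 : ℝ) else 0 := by
        refine Finset.sum_le_sum fun a ha => Finset.sum_le_sum fun d hd => ?_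
        rw [Finset.mem_Ioc] at ha hd
        by_cases h : d ∣ a
        · simp only [h, true_and, if_true]
          rw [← Finset.sum_filter, Finset.sum_const, hcard, nsmul_eq_mul,
            Nat.cast_div h (by exact_mod_cast hd.1.ne')]
          have h1 : (a : ℝ) ≠ 0 := by exact_mod_cast ha.1.ne'
          have h2 : (d : ℝ) ≠ 0 := by exact_mod_cast hd.1.ne'
          field_simp
          exact le_rfl
        · simp [h]
    _ = ∑ d ∈ Finset.Ioc 0 A, ((A / d : ℕ) : ℝ) := by
        rw [Finset.sum_comm]
        refine Finset.sum_congr rfl fun d _ => ?_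
        rw [← Finset.sum_filter, Finset.sum_const, hcard]
        simp
    _ ≤ ∑ d ∈ Finset.Ioc 0 A, (A : ℝ) * (d : ℝ)⁻¹ := by
        refine Finset.sum_le_sum fun d _ => ?_
        rw [← div_eq_mul_inv]
        exact Nat.cast_div_le
    _ ≤ _ := by
        rw [← Finset.mul_sum]
        refine mul_le_mul_of_nonneg_left ?_ (Nat.cast_nonneg _)
        have := harmonic_le_one_add_log A
        rw [harmonic_eq_sum_Icc] at this
        push_cast at this
        exact this

lemma sum_card_congruence_le {p : ℕ} (A N M : ℕ) (hAN : A ≤ N) (hp : A * N ≤ p) :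
    ∑ a ∈ Finset.Ioc 0 A, ∑ b ∈ Finset.Ioc 0 A,
      (((Finset.range N ×ˢ Finset.range N).filter fun q : ℕ × ℕ =>
        (b : ZMod p) * ((M + q.1 : ℕ) : ZMod p) = a * ((M + q.2 : ℕ) : ZMod p)).card : ℝ)
        ≤ A * N * (8 + 4 * Real.log A) := by
  set c : ℕ → ℕ → ℝ := fun a b => (((Finset.range N ×ˢ Finset.range N).filter fun q : ℕ × ℕ =>
        (b : ZMod p) * ((M + q.1 : ℕ) : ZMod p) = a * ((M + q.2 : ℕ) : ZMod p)).card : ℝ) with hc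
  have hc0 : ∀ a b, 0 ≤ c a b := fun a b => Nat.cast_nonneg _
  have hsymm : ∀ a b, c a b = c b a := by
    intro a b
    simp only [hc]
    norm_cast
    refine Finset.card_bij' (fun q _ => q.swap) (fun q _ => q.swap) ?_ ?_ ?_ ?_
    · rintro ⟨m, n⟩ h
      simp only [Finset.mem_filter, Finset.mem_product, Prod.swap] at h ⊢
      exact ⟨h.1.symm, h.2.symm⟩
    · rintro ⟨m, n⟩ h
      simp only [Finset.mem_filter, Finset.mem_product, Prod.swap] at h ⊢
      exact ⟨h.1.symm, h.2.symm⟩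
    · simp
    · simp
  have hbd : ∀ a ∈ Finset.Ioc 0 A, ∀ b ∈ Finset.Ioc 0 A,
      c a b ≤ 2 * (N * (((a.gcd b : ℕ) : ℝ) / a) + 1) := by
    intro a ha b hb
    rw [Finset.mem_Ioc] at ha hb
    have h := card_congruence_le (p := p) A N M a b ha.1 ha.2 hb.1 hb.2 hp
    have h' : c a b ≤ 2 * (((N / (a / a.gcd b) : ℕ) : ℝ) + 1) := by
      simp only [hc]
      exact_mod_cast h
    refine h'.trans ?_
    gcongr
    refine Nat.cast_div_le.trans (le_of_eq ?_)
    have hg : 0 < a.gcd b := Nat.gcd_pos_of_pos_left _ ha.1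
    rw [Nat.cast_div (Nat.gcd_dvd_left _ _) (by exact_mod_cast hg.ne')]
    field_simp
  have hsum : ∑ a ∈ Finset.Ioc 0 A, ∑ b ∈ Finset.Ioc 0 A, c a b ≤
      2 * ∑ a ∈ Finset.Ioc 0 A, ∑ b ∈ Finset.Ioc 0 a, c a b := by
    have h1 : ∀ a ∈ Finset.Ioc 0 A, ∀ f : ℕ → ℝ, ∑ b ∈ Finset.Ioc 0 a, f b =
        ∑ b ∈ Finset.Ioc 0 A, if b ≤ a then f b else 0 := by
      intro a ha f
      rw [← Finset.sum_filter]
      refine Finset.sum_congr ?_ fun _ _ => rfl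
      ext b
      simp only [Finset.mem_Ioc, Finset.mem_filter] at ha ⊢
      omega
    rw [Finset.sum_congr rfl fun a ha => h1 a ha _, two_mul]
    nth_rewrite 3 [Finset.sum_comm]
    rw [← Finset.sum_add_distrib]
    refine Finset.sum_le_sum fun a _ => ?_
    rw [← Finset.sum_add_distrib]
    refine Finset.sum_le_sum fun b _ => ?_
    rcases le_total a b with h | h
    · rw [if_pos h, hsymm b a]
      split_ifs
      · linarith [hc0 a b]
      · linarith
    · rw [if_pos h]
      split_ifs
      · linarith [hc0 b a]
      · linarith
  calc _ ≤ 2 * ∑ a ∈ Finset.Ioc 0 A, ∑ b ∈ Finset.Ioc 0 a, c a b := hsum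
    _ ≤ 2 * ∑ a ∈ Finset.Ioc 0 A, ∑ b ∈ Finset.Ioc 0 a,
          2 * (N * (((a.gcd b : ℕ) : ℝ) / a) + 1) := by
        gcongr with a ha b hb
        refine hbd a ha b ?_
        rw [Finset.mem_Ioc] at ha hb ⊢
        omega
    _ = 4 * N * (∑ a ∈ Finset.Ioc 0 A, ∑ b ∈ Finset.Ioc 0 a, ((a.gcd b : ℕ) : ℝ) / a) +
          4 * ∑ a ∈ Finset.Ioc 0 A, (a : ℝ) := by
        simp only [mul_add, Finset.sum_add_distrib, ← Finset.mul_sum]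
        simp only [Finset.sum_const, Nat.card_Ioc]
        simp only [Finset.mul_sum]
        congr 1
        · refine Finset.sum_congr rfl fun a _ => Finset.sum_congr rfl fun b _ => ?_
          ring
        · refine Finset.sum_congr rfl fun a _ => ?_
          simp
          ring
    _ ≤ 4 * N * (A * (1 + Real.log A)) + 4 * (A * N) := by
        gcongr
        · exact sum_gcd_div_le A
        · calc ∑ a ∈ Finset.Ioc 0 A, (a : ℝ) ≤ ∑ a ∈ Finset.Ioc 0 A, (N : ℝ) := by
                gcongr with a ha
                exact (Finset.mem_Ioc.mp ha).2.trans hAN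
            _ = A * N := by simp
    _ = _ := by ring

end Counting

section Shift

lemma sum_mul_pow_six_le {ι : Type*} (s : Finset ι) (w g : ι → ℝ) (hw : ∀ i, 0 ≤ w i)
    (hg : ∀ i, 0 ≤ g i) :
    (∑ i ∈ s, w i * g i) ^ 6 ≤ (∑ i ∈ s, w i) ^ 4 * (∑ i ∈ s, w i ^ 2) * ∑ i ∈ s, g i ^ 6 := by
  set T := ∑ i ∈ s, w i * g i with hT
  set W := ∑ i ∈ s, w i with hW
  set U := ∑ i ∈ s, w i * g i ^ 2 with hU
  set X := ∑ i ∈ s, w i * g i ^ 3 with hX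
  have hT0 : 0 ≤ T := Finset.sum_nonneg fun i _ => mul_nonneg (hw i) (hg i)
  have hW0 : 0 ≤ W := Finset.sum_nonneg fun i _ => hw i
  have hU0 : 0 ≤ U := Finset.sum_nonneg fun i _ => mul_nonneg (hw i) (pow_nonneg (hg i) _)
  have hX0 : 0 ≤ X := Finset.sum_nonneg fun i _ => mul_nonneg (hw i) (pow_nonneg (hg i) _)
  have h1 : T ^ 2 ≤ W * U := by
    refine Finset.sum_sq_le_sum_mul_sum_of_sq_le_mul s (fun i _ => hw i)
      (fun i _ => mul_nonneg (hw i) (pow_nonneg (hg i) _)) fun i _ => le_of_eq ?_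
    ring
  have h2 : U ^ 2 ≤ T * X := by
    refine Finset.sum_sq_le_sum_mul_sum_of_sq_le_mul s (fun i _ => mul_nonneg (hw i) (hg i))
      (fun i _ => mul_nonneg (hw i) (pow_nonneg (hg i) _)) fun i _ => le_of_eq ?_
    ring
  have h3 : X ^ 2 ≤ (∑ i ∈ s, w i ^ 2) * ∑ i ∈ s, g i ^ 6 := by
    refine Finset.sum_sq_le_sum_mul_sum_of_sq_le_mul s (fun i _ => by positivity)
      (fun i _ => pow_nonneg (hg i) _) fun i _ => le_of_eq ?_
    ring
  have h4 : T ^ 3 ≤ W ^ 2 * X := by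
    rcases hT0.eq_or_lt with h | h
    · rw [← h]
      simpa using mul_nonneg (pow_nonneg hW0 2) hX0
    · refine le_of_mul_le_mul_left ?_ h
      calc T * T ^ 3 = (T ^ 2) ^ 2 := by ring
        _ ≤ (W * U) ^ 2 := by gcongr
        _ = W ^ 2 * U ^ 2 := by ring
        _ ≤ W ^ 2 * (T * X) := by gcongr
        _ = T * (W ^ 2 * X) := by ring
  calc T ^ 6 = (T ^ 3) ^ 2 := by ring
    _ ≤ (W ^ 2 * X) ^ 2 := by gcongr
    _ = W ^ 4 * X ^ 2 := by ring
    _ ≤ W ^ 4 * ((∑ i ∈ s, w i ^ 2) * ∑ i ∈ s, g i ^ 6) := by gcongr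
    _ = _ := by ring

variable {p : ℕ} [hp : Fact p.Prime]

open Classical in
lemma shifted_sum_pow_six_le (e k : ℕ) (hek : e * k = p - 1) (A N M B : ℕ) (hA : 1 ≤ A)
    (hAN : A ≤ N) (hAp : A < p) (hANp : A * N ≤ p) (hB : B ≤ p) (hp3 : 3 ≤ p) :
    (∑ χ : DirichletCharacter ℂ p with χ ^ e = 1 ∧ χ ≠ 1, ∑ q ∈ Finset.Ioc 0 A ×ˢ Finset.range N,
      ‖∑ b : Fin B, χ (((M + q.2 : ℕ) : ZMod p) * (q.1 : ZMod p)⁻¹ + (b : ℕ))‖) ^ 6 ≤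
      (e : ℝ) ^ 6 * (A * N : ℝ) ^ 5 * (12 * Real.log p) *
        (729 * B ^ 3 * p + 46 * B ^ 6 * √(p : ℝ)) := by
  set H := Finset.univ.filter fun χ : DirichletCharacter ℂ p => χ ^ e = 1 ∧ χ ≠ 1 with hH
  set Q := Finset.Ioc 0 A ×ˢ Finset.range N with hQ
  let f : ℕ × ℕ → ZMod p := fun q => ((M + q.2 : ℕ) : ZMod p) * (q.1 : ZMod p)⁻¹
  let ν : ZMod p → ℝ := fun x => ((Q.filter fun q => f q = x).card : ℝ)
  let g : DirichletCharacter ℂ p × ZMod p → ℝ := fun c => ‖∑ b : Fin B, c.1 (c.2 + (b : ℕ))‖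
  have hHe : (H.card : ℝ) ≤ e := by
    rw [← card_pow_eq_one (p := p) e k hek]
    norm_cast
    exact Finset.card_le_card fun χ hχ => by
      simp only [hH, Finset.mem_filter, Finset.mem_univ, true_and] at hχ ⊢
      exact hχ.1
  have hLHS : ∑ χ ∈ H, ∑ q ∈ Q, ‖∑ b : Fin B, χ (f q + (b : ℕ))‖ =
      ∑ c ∈ H ×ˢ (Finset.univ : Finset (ZMod p)), ν c.2 * g c := by
    rw [Finset.sum_product]
    refine Finset.sum_congr rfl fun χ _ => ?_
    rw [← Finset.sum_fiberwise Q f]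
    refine Finset.sum_congr rfl fun x _ => ?_
    rw [Finset.sum_congr rfl (g := fun _ => g (χ, x)) fun q hq => by
      rw [(Finset.mem_filter.mp hq).2]]
    simp [ν]
  have hν1 : ∑ x, ν x = A * N := by
    have := Finset.card_eq_sum_card_fiberwise (f := f) (s := Q) (t := Finset.univ) (by simp)
    rw [hQ, Finset.card_product, Nat.card_Ioc, Finset.card_range] at this
    simp only [ν]
    norm_cast
    exact this.symm
  have hν2 : ∑ x, ν x ^ 2 ≤ A * N * (12 * Real.log p) := by
    have h1 : ∑ x, ν x ^ 2 = ∑ a ∈ Finset.Ioc 0 A, ∑ b ∈ Finset.Ioc 0 A,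
      (((Finset.range N ×ˢ Finset.range N).filter fun q : ℕ × ℕ =>
        (b : ZMod p) * ((M + q.1 : ℕ) : ZMod p) = a * ((M + q.2 : ℕ) : ZMod p)).card : ℝ) := by
      have h2 : ∀ x, ν x ^ 2 = ∑ q ∈ Q, ∑ r ∈ Q, if f q = x ∧ f r = x then (1 : ℝ) else 0 := by
        intro x
        simp only [ν, Finset.card_filter, sq]
        push_cast
        rw [Finset.sum_mul_sum]
        refine Finset.sum_congr rfl fun q _ => Finset.sum_congr rfl fun r _ => ?_
        split_ifs <;> simp_all
      simp only [h2]
      rw [Finset.sum_comm, Finset.sum_congr rfl fun q _ => Finset.sum_comm]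
      rw [hQ, Finset.sum_product]
      refine Finset.sum_congr rfl fun a ha => ?_
      rw [Finset.sum_congr rfl fun n _ => Finset.sum_product _ _ _, Finset.sum_comm]
      refine Finset.sum_congr rfl fun b hb => ?_
      rw [Finset.card_filter, Finset.sum_product]
      push_cast
      refine Finset.sum_congr rfl fun m _ => Finset.sum_congr rfl fun n _ => ?_
      have hne : ∀ c ∈ Finset.Ioc 0 A, (c : ZMod p) ≠ 0 := by
        intro c hc h0
        rw [Finset.mem_Ioc] at hc
        rw [ZMod.natCast_eq_zero_iff] at h0
        exact absurd (Nat.le_of_dvd hc.1 h0) (by omega)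
      have hiff : f (a, m) = f (b, n) ↔
          (b : ZMod p) * ((M + m : ℕ) : ZMod p) = a * ((M + n : ℕ) : ZMod p) := by
        simp only [f]
        rw [← div_eq_mul_inv, ← div_eq_mul_inv, div_eq_div_iff (hne a ha) (hne b hb),
          mul_comm (b : ZMod p), mul_comm (a : ZMod p)]
      push_cast at hiff
      simp only [← hiff]
      rw [Finset.sum_eq_single (f (a, m))]
      · simp [eq_comm]
      · intro x _ hx
        rw [if_neg]
        exact fun h => hx h.1.symm
      · simp
    rw [h1]
    refine (sum_card_congruence_le A N M hAN hANp).trans ?_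
    gcongr
    have hlog : 1 ≤ Real.log p := by
      rw [Real.le_log_iff_exp_le (by positivity)]
      have : (3 : ℝ) ≤ p := by exact_mod_cast hp3
      linarith [Real.exp_one_lt_d9]
    have : Real.log A ≤ Real.log p :=
      Real.log_le_log (by exact_mod_cast hA) (by exact_mod_cast hAp.le)
    linarith
  have hw1 : ∑ c ∈ H ×ˢ (Finset.univ : Finset (ZMod p)), ν c.2 ≤ e * (A * N) := by
    rw [Finset.sum_product]
    change ∑ χ ∈ H, ∑ x, ν x ≤ _
    rw [hν1, Finset.sum_const, nsmul_eq_mul]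
    exact mul_le_mul_of_nonneg_right hHe (by positivity)
  have hw2 : ∑ c ∈ H ×ˢ (Finset.univ : Finset (ZMod p)), ν c.2 ^ 2 ≤
      e * (A * N * (12 * Real.log p)) := by
    rw [Finset.sum_product]
    change ∑ χ ∈ H, ∑ x, ν x ^ 2 ≤ _
    rw [Finset.sum_const, nsmul_eq_mul]
    exact mul_le_mul hHe hν2 (Finset.sum_nonneg fun x _ => sq_nonneg _) (Nat.cast_nonneg _)
  have hg6 : ∑ c ∈ H ×ˢ (Finset.univ : Finset (ZMod p)), g c ^ 6 ≤
      e * (729 * B ^ 3 * p + 46 * B ^ 6 * √(p : ℝ)) := by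
    rw [Finset.sum_product]
    exact sixth_moment_le e k hek B hB
  have hν0 : ∀ x, 0 ≤ ν x := fun x => Nat.cast_nonneg _
  have h1 : 0 ≤ ∑ c ∈ H ×ˢ (Finset.univ : Finset (ZMod p)), ν c.2 :=
    Finset.sum_nonneg fun c _ => hν0 _
  have h2 : 0 ≤ ∑ c ∈ H ×ˢ (Finset.univ : Finset (ZMod p)), g c ^ 6 :=
    Finset.sum_nonneg fun c _ => pow_nonneg (norm_nonneg _) 6
  have h3 : 0 ≤ ∑ c ∈ H ×ˢ (Finset.univ : Finset (ZMod p)), ν c.2 ^ 2 :=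
    Finset.sum_nonneg fun c _ => sq_nonneg _
  have key : (∑ χ ∈ H, ∑ q ∈ Q, ‖∑ b : Fin B, χ (f q + (b : ℕ))‖) ^ 6 ≤
      (e * (A * N : ℝ)) ^ 4 * (e * (A * N * (12 * Real.log p))) *
        (e * (729 * B ^ 3 * p + 46 * B ^ 6 * √(p : ℝ))) := by
    rw [hLHS]
    refine (sum_mul_pow_six_le (H ×ˢ (Finset.univ : Finset (ZMod p))) (fun c => ν c.2) g
      (fun c => hν0 _) (fun c => norm_nonneg _)).trans ?_
    exact mul_le_mul (mul_le_mul (pow_le_pow_left₀ h1 hw1 4) hw2 h3 (pow_nonneg (h1.trans hw1) 4))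
      hg6 h2 (mul_nonneg (pow_nonneg (h1.trans hw1) 4) (h3.trans hw2))
  refine le_of_le_of_eq key ?_
  ring

end Shift

section Burgess

lemma burgess_exponents (A B N P R L e l q : ℝ) (hA : 0 ≤ A) (hB : 0 ≤ B) (hN : 0 ≤ N)
    (hP : 0 ≤ P) (hl : 0 ≤ l) (hR3 : R ^ 3 = N ^ 2) (hL6 : L ^ 6 = P ^ 4 * l)
    (hq : P ^ 6 = q) (hBP : B ≤ P) (hPB : P ≤ 2 * B) (hNAB' : N ≤ 32 * (A * B)) :
    e ^ 6 * (A * N) ^ 5 * (12 * l) * (729 * B ^ 3 * q + 46 * B ^ 6 * P ^ 3) ≤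
      (15 * (A * B) * e * R * L) ^ 6 := by
  subst hq
  have h3 : (15 * (A * B) * e * R * L) ^ 6 =
    (15 * (A * B) * e) ^ 6 * (R ^ 3) ^ 2 * L ^ 6 := by ring
  rw [h3, hR3, hL6]
  have h4 : 729 * B ^ 3 * P ^ 6 + 46 * B ^ 6 * P ^ 3 ≤ 775 * P ^ 9 := by
    calc _ ≤ 729 * P ^ 3 * P ^ 6 + 46 * P ^ 6 * P ^ 3 := by gcongr
      _ = _ := by ring
  have h5 : N * P ^ 5 ≤ 1024 * (A * B ^ 6) := by
    calc N * P ^ 5 ≤ (32 * (A * B)) * (2 * B) ^ 5 := by gcongr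
      _ = _ := by ring
  calc e ^ 6 * (A * N) ^ 5 * (12 * l) * (729 * B ^ 3 * P ^ 6 + 46 * B ^ 6 * P ^ 3)
      ≤ e ^ 6 * (A * N) ^ 5 * (12 * l) * (775 * P ^ 9) := by gcongr
    _ = 9300 * e ^ 6 * A ^ 5 * N ^ 4 * P ^ 4 * l * (N * P ^ 5) := by ring
    _ ≤ 9300 * e ^ 6 * A ^ 5 * N ^ 4 * P ^ 4 * l * (1024 * (A * B ^ 6)) := by gcongr
    _ = 9300 * 1024 * (e ^ 6 * A ^ 6 * N ^ 4 * P ^ 4 * l * B ^ 6) := by ring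
    _ ≤ 15 ^ 6 * (e ^ 6 * A ^ 6 * N ^ 4 * P ^ 4 * l * B ^ 6) := by
        gcongr; norm_num
    _ = _ := by ring

variable {p : ℕ} [hp : Fact p.Prime]

/-- The sum of `χ` over the interval `[M, M + N)`. -/
noncomputable def charSum (χ : DirichletCharacter ℂ p) (M N : ℕ) : ℂ :=
  ∑ n ∈ Finset.range N, χ ((M + n : ℕ) : ZMod p)

lemma charSum_shift (χ : DirichletCharacter ℂ p) (M N h : ℕ) :
    charSum χ M N = charSum χ (M + h) N + (charSum χ M h - charSum χ (M + N) h) := by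
  have h1 : charSum χ M (h + N) = charSum χ M h + charSum χ (M + h) N := by
    simp only [charSum, Finset.sum_range_add, add_assoc]
  have h2 : charSum χ M (N + h) = charSum χ M N + charSum χ (M + N) h := by
    simp only [charSum, Finset.sum_range_add, add_assoc]
  rw [add_comm N h, h1] at h2
  linear_combination -h2

lemma norm_charSum_le (χ : DirichletCharacter ℂ p) (M N : ℕ) : ‖charSum χ M N‖ ≤ N := by
  refine (norm_sum_le _ _).trans ?_
  calc _ ≤ ∑ n ∈ Finset.range N, (1 : ℝ) :=
        Finset.sum_le_sum fun n _ => DirichletCharacter.norm_le_one χ _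
    _ = N := by simp

lemma mul_norm_charSum_le (χ : DirichletCharacter ℂ p) (M N A B : ℕ) (hAp : A < p) :
    (A * B : ℝ) * ‖charSum χ M N‖ ≤
      ∑ q ∈ Finset.Ioc 0 A ×ˢ Finset.range N,
        ‖∑ b : Fin B, χ (((M + q.2 : ℕ) : ZMod p) * (q.1 : ZMod p)⁻¹ + (b : ℕ))‖ +
      ∑ a ∈ Finset.Ioc 0 A, ∑ b : Fin B,
        (‖charSum χ M (a * b)‖ + ‖charSum χ (M + N) (a * b)‖) := by
  have h1 : (A * B : ℂ) * charSum χ M N =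
      ∑ q ∈ Finset.Ioc 0 A ×ˢ Finset.range N, χ (q.1 : ZMod p) *
        ∑ b : Fin B, χ (((M + q.2 : ℕ) : ZMod p) * (q.1 : ZMod p)⁻¹ + (b : ℕ)) +
      ∑ a ∈ Finset.Ioc 0 A, ∑ b : Fin B,
        (charSum χ M (a * b) - charSum χ (M + N) (a * b)) := by
    calc (A * B : ℂ) * charSum χ M N = ∑ a ∈ Finset.Ioc 0 A, ∑ b : Fin B, charSum χ M N := by
          simp [mul_assoc]
      _ = ∑ a ∈ Finset.Ioc 0 A, ∑ b : Fin B, charSum χ (M + a * b) N +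
          ∑ a ∈ Finset.Ioc 0 A, ∑ b : Fin B,
            (charSum χ M (a * b) - charSum χ (M + N) (a * b)) := by
          rw [← Finset.sum_add_distrib]
          refine Finset.sum_congr rfl fun a _ => ?_
          rw [← Finset.sum_add_distrib]
          exact Finset.sum_congr rfl fun b _ => charSum_shift χ M N (a * b)
      _ = _ := by
          congr 1
          rw [Finset.sum_product]
          refine Finset.sum_congr rfl fun a ha => ?_
          simp only [charSum]
          rw [Finset.sum_comm]
          refine Finset.sum_congr rfl fun n _ => ?_
          rw [Finset.mul_sum]
          refine Finset.sum_congr rfl fun b _ => ?_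
          rw [← map_mul]
          congr 1
          have hne : (a : ZMod p) ≠ 0 := by
            intro h0
            rw [Finset.mem_Ioc] at ha
            rw [ZMod.natCast_eq_zero_iff] at h0
            exact absurd (Nat.le_of_dvd ha.1 h0) (by omega)
          push_cast
          field_simp
          ring
  have h2 : (A * B : ℝ) * ‖charSum χ M N‖ = ‖(A * B : ℂ) * charSum χ M N‖ := by
    simp
  rw [h2, h1]
  refine (norm_add_le _ _).trans (add_le_add ?_ ?_)
  · refine (norm_sum_le _ _).trans (Finset.sum_le_sum fun q _ => ?_)
    rw [norm_mul]
    exact mul_le_of_le_one_left (norm_nonneg _) (DirichletCharacter.norm_le_one χ _)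
  · refine (norm_sum_le _ _).trans (Finset.sum_le_sum fun a _ => ?_)
    exact (norm_sum_le _ _).trans (Finset.sum_le_sum fun b _ => norm_sub_le _ _)

open Classical in
lemma card_nontrivial_pow_eq_one_le (e k : ℕ) (hek : e * k = p - 1) :
    ((Finset.univ.filter fun χ : DirichletCharacter ℂ p => χ ^ e = 1 ∧ χ ≠ 1).card : ℝ) ≤ e := by
  have h : (Finset.univ.filter fun χ : DirichletCharacter ℂ p => χ ^ e = 1 ∧ χ ≠ 1).card ≤
      (Finset.univ.filter fun χ : DirichletCharacter ℂ p => χ ^ e = 1).card :=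
    Finset.card_le_card fun χ hχ => by
      simp only [Finset.mem_filter, Finset.mem_univ, true_and] at hχ ⊢
      exact hχ.1
  rw [card_pow_eq_one (p := p) e k hek] at h
  exact_mod_cast h

lemma one_le_log_of_three_le {n : ℕ} (hn : 3 ≤ n) : 1 ≤ Real.log n := by
  have : (3 : ℝ) ≤ n := by exact_mod_cast hn
  rw [Real.le_log_iff_exp_le (by positivity)]
  linarith [Real.exp_one_lt_d9]

set_option maxHeartbeats 1000000 in
open Classical in
/-- Burgess' bound with exponent `r = 3`, on average over the nontrivial characters of order
dividing `e`. -/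
lemma sum_norm_charSum_le (e k : ℕ) (hek : e * k = p - 1) (hp3 : 3 ≤ p) (N : ℕ)
    (hN : N ^ 12 ≤ p ^ 7) (M : ℕ) :
    ∑ χ : DirichletCharacter ℂ p with χ ^ e = 1 ∧ χ ≠ 1, ‖charSum χ M N‖ ≤
      30 * e * (N : ℝ) ^ (2 / 3 : ℝ) *
        ((p : ℝ) ^ (1 / 9 : ℝ) * Real.log p ^ (1 / 6 : ℝ)) := by
  set H := Finset.univ.filter fun χ : DirichletCharacter ℂ p => χ ^ e = 1 ∧ χ ≠ 1 with hH
  have hHe : (H.card : ℝ) ≤ e := card_nontrivial_pow_eq_one_le e k hek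
  have hlog : 1 ≤ Real.log p := one_le_log_of_three_le hp3
  have hp1 : (1 : ℝ) ≤ p := by exact_mod_cast (by omega : 1 ≤ p)
  set P : ℝ := (p : ℝ) ^ (1 / 6 : ℝ) with hP
  have hP1 : 1 ≤ P := Real.one_le_rpow hp1 (by norm_num)
  have hP6 : P ^ 6 = p := by
    rw [hP, ← Real.rpow_natCast, ← Real.rpow_mul (by positivity)]; norm_num
  have hPs : √(p : ℝ) = P ^ 3 := by
    rw [Real.sqrt_eq_iff_mul_self_eq (by positivity) (by positivity), ← hP6]; ring
  set L : ℝ := (p : ℝ) ^ (1 / 9 : ℝ) * Real.log p ^ (1 / 6 : ℝ) with hL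
  have hL6 : L ^ 6 = P ^ 4 * Real.log p := by
    rw [hL, mul_pow, hP, ← Real.rpow_natCast, ← Real.rpow_natCast, ← Real.rpow_natCast,
      ← Real.rpow_mul (by positivity), ← Real.rpow_mul (by positivity),
      ← Real.rpow_mul (by positivity)]
    norm_num
  have hL0 : 0 ≤ L := by positivity
  have hR : ∀ n : ℕ, ((n : ℝ) ^ (2 / 3 : ℝ)) ^ 3 = (n : ℝ) ^ 2 := by
    intro n
    rw [← Real.rpow_natCast, ← Real.rpow_natCast, ← Real.rpow_mul (by positivity)]; norm_num
  induction N using Nat.strong_induction_on generalizing M with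
  | _ N ih =>
  set R : ℝ := (N : ℝ) ^ (2 / 3 : ℝ) with hRdef
  have hR3 : R ^ 3 = (N : ℝ) ^ 2 := hR N
  have hR0 : 0 ≤ R := by positivity
  by_cases hsmall : (N : ℝ) ≤ 27000 * P ^ 2
  · have h1 : ∑ χ ∈ H, ‖charSum χ M N‖ ≤ e * N := by
      calc _ ≤ ∑ χ ∈ H, (N : ℝ) := Finset.sum_le_sum fun χ _ => norm_charSum_le χ M N
        _ = H.card * N := by rw [Finset.sum_const, nsmul_eq_mul]
        _ ≤ e * N := by gcongr
    refine h1.trans ?_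
    have h2 : (N : ℝ) ≤ 30 * R * L := by
      refine le_of_pow_le_pow_left₀ (n := 6) (by norm_num) (by positivity) ?_
      have h3 : (30 * R * L) ^ 6 = 27000 ^ 2 * (R ^ 3) ^ 2 * L ^ 6 := by ring
      rw [h3, hR3, hL6]
      calc (N : ℝ) ^ 6 = (N ^ 2) ^ 2 * N ^ 2 := by ring
        _ ≤ (N ^ 2) ^ 2 * (27000 * P ^ 2) ^ 2 := by gcongr
        _ = 27000 ^ 2 * ((N : ℝ) ^ 2) ^ 2 * (P ^ 4 * 1) := by ring
        _ ≤ _ := by gcongr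
    calc (e : ℝ) * N ≤ e * (30 * R * L) := by gcongr
      _ = _ := by ring
  · push Not at hsmall
    have hPN : 27000 * P ≤ N := by nlinarith
    set B := ⌊P⌋₊ with hB
    have hBP : (B : ℝ) ≤ P := Nat.floor_le (by positivity)
    have hB1 : 1 ≤ B := Nat.le_floor (by simpa using hP1)
    have hB1' : (1 : ℝ) ≤ B := by exact_mod_cast hB1
    have hPB : P ≤ 2 * B := by
      have := Nat.lt_floor_add_one P
      linarith
    set A := N / (16 * B) with hA
    have hAB : 16 * (A * B) ≤ N := by
      have := Nat.div_mul_le_self N (16 * B)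
      calc 16 * (A * B) = A * (16 * B) := by ring
        _ ≤ N := this
    have hA1 : 1 ≤ A := by
      rw [hA, Nat.le_div_iff_mul_le (by positivity)]
      have : (16 * B : ℝ) ≤ N := by linarith
      have : 16 * B ≤ N := by exact_mod_cast this
      linarith
    have hA1' : (1 : ℝ) ≤ A := by exact_mod_cast hA1
    have hNAB : N ≤ 32 * (A * B) := by
      have h1 := Nat.lt_div_mul_add (a := N) (b := 16 * B) (by positivity)
      have h2 : N / (16 * B) * (16 * B) = 16 * (A * B) := by rw [← hA]; ring
      nlinarith
    have hAB' : 16 * ((A : ℝ) * B) ≤ N := by exact_mod_cast hAB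
    have hNAB' : (N : ℝ) ≤ 32 * (A * B) := by exact_mod_cast hNAB
    have hN2 : (N : ℝ) ^ 2 ≤ P ^ 7 := by
      refine le_of_pow_le_pow_left₀ (n := 6) (by norm_num) (by positivity) ?_
      calc ((N : ℝ) ^ 2) ^ 6 = (N : ℝ) ^ 12 := by ring
        _ ≤ (p : ℝ) ^ 7 := by exact_mod_cast hN
        _ = (P ^ 7) ^ 6 := by rw [← hP6]; ring
    have hAN : A ≤ N := by nlinarith
    have hANp : A * N ≤ p := by
      have : (A * N : ℝ) ≤ p := by
        rw [← hP6]
        have h1 : (A : ℝ) * B * N ≤ P ^ 7 / 16 := by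
          have : (A : ℝ) * B * N ≤ N / 16 * N := by gcongr; linarith
          nlinarith
        have h2 : (A : ℝ) * N * P ≤ P ^ 6 * P := by
          calc (A : ℝ) * N * P ≤ A * N * (2 * B) := by gcongr
            _ = 2 * (A * B * N) := by ring
            _ ≤ 2 * (P ^ 7 / 16) := by gcongr
            _ ≤ P ^ 6 * P := by
                have : 0 < P ^ 7 := by positivity
                nlinarith
        exact le_of_mul_le_mul_right h2 (by positivity)
      exact_mod_cast this
    have hN2' : 2 ≤ N := by
      have : (2 : ℝ) ≤ N := by linarith
      exact_mod_cast this
    have hAp : A < p := by nlinarith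
    have hBp : B ≤ p := by
      have : (B : ℝ) ≤ p := by
        rw [← hP6]
        exact hBP.trans (le_self_pow₀ hP1 (by norm_num))
      exact_mod_cast this
    set T := ∑ χ ∈ H, ∑ q ∈ Finset.Ioc 0 A ×ˢ Finset.range N,
      ‖∑ b : Fin B, χ (((M + q.2 : ℕ) : ZMod p) * (q.1 : ZMod p)⁻¹ + (b : ℕ))‖ with hT
    have hT6 := shifted_sum_pow_six_le e k hek A N M B hA1 hAN hAp hANp hBp hp3
    rw [← hH, ← hT, hPs] at hT6
    have hTle : T ≤ 15 * (A * B) * e * R * L := by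
      refine le_of_pow_le_pow_left₀ (n := 6) (by norm_num) (by positivity) ?_
      refine hT6.trans ?_
      exact burgess_exponents _ _ _ _ _ _ _ _ _ (by positivity) (by positivity)
        (by positivity) (by positivity) (by positivity) hR3 hL6 hP6 hBP hPB hNAB'
    have hIH : ∀ M' : ℕ, ∀ a ∈ Finset.Ioc 0 A, ∀ b : Fin B,
        ∑ χ ∈ H, ‖charSum χ M' (a * b)‖ ≤ 5 * e * R * L := by
      intro M' a ha b
      rw [Finset.mem_Ioc] at ha
      have hab : a * (b : ℕ) ≤ A * B := Nat.mul_le_mul ha.2 b.2.le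
      have hlt : a * (b : ℕ) < N := by nlinarith
      refine (ih (a * b) hlt ((Nat.pow_le_pow_left hlt.le 12).trans hN) M').trans ?_
      have h6 : (((a * b : ℕ) : ℝ)) ^ (2 / 3 : ℝ) ≤ R / 6 := by
        refine le_of_pow_le_pow_left₀ (n := 3) (by norm_num) (by positivity) ?_
        rw [hR, div_pow, hR3]
        have h7 : ((a * b : ℕ) : ℝ) ≤ N / 16 := by
          have : ((a * b : ℕ) : ℝ) ≤ A * B := by exact_mod_cast hab
          linarith
        calc ((a * b : ℕ) : ℝ) ^ 2 ≤ (N / 16) ^ 2 := by gcongr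
          _ ≤ _ := by
            have : (0 : ℝ) ≤ N ^ 2 := by positivity
            rw [div_pow]
            gcongr
            norm_num
      calc _ ≤ 30 * e * (R / 6) * L := by gcongr
        _ = _ := by ring
    have hfinal : (A * B : ℝ) * ∑ χ ∈ H, ‖charSum χ M N‖ ≤ (A * B) * (30 * e * R * L) := by
      calc (A * B : ℝ) * ∑ χ ∈ H, ‖charSum χ M N‖ = ∑ χ ∈ H, (A * B : ℝ) * ‖charSum χ M N‖ := by
            rw [Finset.mul_sum]
        _ ≤ T + ∑ χ ∈ H, ∑ a ∈ Finset.Ioc 0 A, ∑ b : Fin B,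
            (‖charSum χ M (a * b)‖ + ‖charSum χ (M + N) (a * b)‖) := by
            rw [hT, ← Finset.sum_add_distrib]
            exact Finset.sum_le_sum fun χ _ => mul_norm_charSum_le χ M N A B hAp
        _ = T + ∑ a ∈ Finset.Ioc 0 A, ∑ b : Fin B, (∑ χ ∈ H, ‖charSum χ M (a * b)‖ +
              ∑ χ ∈ H, ‖charSum χ (M + N) (a * b)‖) := by
            rw [Finset.sum_comm, Finset.sum_congr rfl fun a _ => Finset.sum_comm]
            simp only [Finset.sum_add_distrib]
        _ ≤ 15 * (A * B) * e * R * L + ∑ a ∈ Finset.Ioc 0 A, ∑ b : Fin B,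
              (5 * e * R * L + 5 * e * R * L) := by
            refine add_le_add hTle (Finset.sum_le_sum fun a ha => Finset.sum_le_sum fun b _ => ?_)
            exact add_le_add (hIH M a ha b) (hIH (M + N) a ha b)
        _ = (A * B) * (25 * e * R * L) := by
            simp only [Finset.sum_const, Finset.card_univ, Fintype.card_fin, Nat.card_Ioc,
              nsmul_eq_mul, Nat.sub_zero]
            ring
        _ ≤ _ := by gcongr; norm_num
    exact le_of_mul_le_mul_left hfinal (by positivity)

end Burgess

section PolyaVinogradov

variable {p : ℕ} [hp : Fact p.Prime]

lemma norm_gaussSum_stdAddChar (χ : DirichletCharacter ℂ p) (hχ : χ ≠ 1) :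
    ‖gaussSum χ (ZMod.stdAddChar (N := p))‖ = √(p : ℝ) := by
  have h := gaussSum_mul_gaussSum_eq_card hχ (ZMod.isPrimitive_stdAddChar p)
  rw [← star_gaussSum_eq, RCLike.star_def, Complex.mul_conj', ZMod.card] at h
  have h' : ‖gaussSum χ (ZMod.stdAddChar (N := p))‖ ^ 2 = p := by exact_mod_cast h
  rw [← h', Real.sqrt_sq (norm_nonneg _)]

lemma apply_mul_gaussSum_inv (χ : DirichletCharacter ℂ p) (hχ : χ ≠ 1) (n : ZMod p) :
    χ n * gaussSum χ⁻¹ (ZMod.stdAddChar (N := p)) =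
      ∑ a : ZMod p, χ⁻¹ a * ZMod.stdAddChar (n * a) := by
  rcases eq_or_ne n 0 with rfl | hn
  · simp only [MulChar.map_zero, zero_mul, AddChar.map_zero_eq_one, mul_one]
    exact (MulChar.sum_eq_zero_of_ne_one (inv_ne_one.mpr hχ)).symm
  · have h := gaussSum_mulShift_eq χ⁻¹ (ZMod.stdAddChar (N := p)) (Units.mk0 n hn)
    rw [inv_inv] at h
    simp only [Units.val_mk0] at h
    rw [← h]
    simp only [gaussSum, AddChar.mulShift_apply]

lemma norm_sum_stdAddChar_le (a : ZMod p) (ha : a ≠ 0) (N : ℕ) :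
    ‖∑ n ∈ Finset.range N, ZMod.stdAddChar ((n : ZMod p) * a)‖ ≤
      (p : ℝ) / 2 * ((a.val : ℝ)⁻¹ + ((p : ℝ) - a.val)⁻¹) := by
  have hp0 : (0 : ℝ) < p := by exact_mod_cast hp.out.pos
  set j := a.val with hj
  have hj0 : (0 : ℝ) < j := by
    have : 0 < j := Nat.pos_of_ne_zero (by rwa [hj, Ne, ZMod.val_eq_zero])
    exact_mod_cast this
  have hjp : (j : ℝ) < p := by exact_mod_cast ZMod.val_lt a
  have hz : ‖ZMod.stdAddChar a - 1‖ = 2 * Real.sin (Real.pi * j / p) := by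
    have h1 : a = ((j : ℤ) : ZMod p) := by simp [hj]
    rw [h1, ZMod.stdAddChar_coe]
    have h2 : 2 * (Real.pi : ℂ) * Complex.I * ((j : ℤ) : ℂ) / p =
        Complex.I * ((2 * (Real.pi * j / p) : ℝ) : ℂ) := by
      push_cast
      ring
    rw [h2, Complex.norm_exp_I_mul_ofReal_sub_one, Real.norm_eq_abs, abs_of_nonneg]
    · congr 2; ring
    · refine mul_nonneg zero_le_two (Real.sin_nonneg_of_nonneg_of_le_pi (by positivity) ?_)
      rw [mul_div_cancel_left₀ _ two_ne_zero, div_le_iff₀ hp0]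
      gcongr
  have hsin : 2 / (p : ℝ) * min (j : ℝ) (p - j) ≤ Real.sin (Real.pi * j / p) := by
    have key : ∀ y : ℝ, 0 ≤ y → y ≤ p / 2 → 2 / (p : ℝ) * y ≤ Real.sin (Real.pi * y / p) := by
      intro y hy hy2
      have := Real.mul_le_sin (x := Real.pi * y / p) (by positivity) (by
        rw [div_le_iff₀ hp0]
        have := mul_le_mul_of_nonneg_left hy2 Real.pi_pos.le
        linarith)
      refine le_trans (le_of_eq ?_) this
      field_simp
    rcases le_total (j : ℝ) (p / 2) with h | h
    · rw [min_eq_left (by linarith)]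
      exact key _ hj0.le h
    · rw [min_eq_right (by linarith)]
      have := key (p - j) (by linarith) (by linarith)
      rwa [show Real.pi * (p - j) / p = Real.pi - Real.pi * j / p by field_simp,
        Real.sin_pi_sub] at this
  have hmin : 0 < min (j : ℝ) (p - j) := lt_min hj0 (by linarith)
  have hpos : 0 < ‖ZMod.stdAddChar a - 1‖ := by
    rw [hz]
    have : 0 < 2 / (p : ℝ) * min (j : ℝ) (p - j) := by positivity
    linarith
  have hne : ZMod.stdAddChar a ≠ 1 := sub_ne_zero.mp (norm_pos_iff.mp hpos)
  have hgeom : ∑ n ∈ Finset.range N, ZMod.stdAddChar ((n : ZMod p) * a) =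
      (ZMod.stdAddChar a ^ N - 1) / (ZMod.stdAddChar a - 1) := by
    rw [← geom_sum_eq hne]
    refine Finset.sum_congr rfl fun n _ => ?_
    rw [← nsmul_eq_mul, AddChar.map_nsmul_eq_pow]
  rw [hgeom, norm_div]
  have hnum : ‖ZMod.stdAddChar a ^ N - 1‖ ≤ 2 := by
    refine (norm_sub_le _ _).trans ?_
    rw [norm_pow, AddChar.norm_apply, norm_one]
    norm_num
  calc _ ≤ 2 / (2 * (2 / (p : ℝ) * min (j : ℝ) (p - j))) := by
        gcongr
        rw [hz]
        gcongr
    _ = (p : ℝ) / 2 * (min (j : ℝ) (p - j))⁻¹ := by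
        field_simp
    _ ≤ _ := by
        gcongr
        have h1 : 0 < ((p : ℝ) - j)⁻¹ := inv_pos.mpr (by linarith)
        have h2 : 0 < (j : ℝ)⁻¹ := inv_pos.mpr hj0
        rcases min_choice (j : ℝ) (p - j) with h | h <;> rw [h] <;> linarith

/-- The Pólya–Vinogradov inequality. -/
lemma norm_charSum_le_sqrt_mul_log (hp3 : 3 ≤ p) (χ : DirichletCharacter ℂ p) (hχ : χ ≠ 1)
    (N : ℕ) : ‖charSum χ 0 N‖ ≤ 2 * √(p : ℝ) * Real.log p := by
  have hp0 : (0 : ℝ) < p := by exact_mod_cast hp.out.pos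
  have hs0 : 0 < √(p : ℝ) := Real.sqrt_pos.mpr hp0
  have hlog := one_le_log_of_three_le hp3
  set G := gaussSum χ⁻¹ (ZMod.stdAddChar (N := p)) with hG
  have hnG : ‖G‖ = √(p : ℝ) := norm_gaussSum_stdAddChar χ⁻¹ (inv_ne_one.mpr hχ)
  let F : ℕ → ℝ := fun j => (p : ℝ) / 2 * ((j : ℝ)⁻¹ + ((p : ℝ) - j)⁻¹)
  have hmain : ‖charSum χ 0 N * G‖ ≤ ∑ a : ZMod p, F a.val := by
    have h1 : charSum χ 0 N * G = ∑ a : ZMod p, χ⁻¹ a *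
        ∑ n ∈ Finset.range N, ZMod.stdAddChar ((n : ZMod p) * a) := by
      simp only [charSum, zero_add, Finset.sum_mul, hG, apply_mul_gaussSum_inv χ hχ,
        Finset.mul_sum]
      rw [Finset.sum_comm]
    rw [h1]
    refine (norm_sum_le _ _).trans (Finset.sum_le_sum fun a _ => ?_)
    rcases eq_or_ne a 0 with rfl | ha
    · simp only [MulChar.map_zero, zero_mul, norm_zero, F]
      have : (0 : ℝ) ≤ p - (0 : ZMod p).val := by simp
      positivity
    · rw [norm_mul]
      refine (mul_le_of_le_one_left (norm_nonneg _) (DirichletCharacter.norm_le_one _ _)).trans ?_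
      exact norm_sum_stdAddChar_le a ha N
  have hval : ∑ a : ZMod p, F a.val = ∑ j ∈ Finset.range p, F j := by
    refine Finset.sum_nbij' ZMod.val (fun j => (j : ZMod p)) ?_ ?_ ?_ ?_ ?_
    · intro a _; exact Finset.mem_range.mpr (ZMod.val_lt a)
    · simp
    · intro a _; simp
    · intro j hj; exact ZMod.val_cast_of_lt (Finset.mem_range.mp hj)
    · simp
  have hH : ((harmonic p : ℚ) : ℝ) = ∑ i ∈ Finset.range p, ((i : ℝ) + 1)⁻¹ := by
    simp [harmonic]
  have h1 : ∑ j ∈ Finset.range p, (j : ℝ)⁻¹ ≤ 1 + Real.log p := by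
    refine le_trans ?_ (harmonic_le_one_add_log p)
    rw [hH]
    have h2 := Finset.sum_range_succ' (fun j : ℕ => (j : ℝ)⁻¹) p
    have h3 := Finset.sum_range_succ (fun j : ℕ => (j : ℝ)⁻¹) p
    push_cast at h2
    have h4 : (0 : ℝ) ≤ (p : ℝ)⁻¹ := by positivity
    simp only [inv_zero, add_zero] at h2
    linarith
  have h2 : ∑ j ∈ Finset.range p, ((p : ℝ) - j)⁻¹ ≤ 1 + Real.log p := by
    refine le_trans (le_of_eq ?_) (harmonic_le_one_add_log p)
    rw [hH, ← Finset.sum_range_reflect]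
    refine Finset.sum_congr rfl fun j hj => ?_
    rw [Finset.mem_range] at hj
    rw [Nat.cast_sub (by omega), Nat.cast_sub (by omega)]
    congr 1
    push_cast
    ring
  have hF : ∑ j ∈ Finset.range p, F j ≤ 2 * p * Real.log p := by
    simp only [F]
    rw [← Finset.mul_sum, Finset.sum_add_distrib]
    nlinarith
  rw [norm_mul, hnG, hval] at hmain
  refine le_of_mul_le_mul_right ?_ hs0
  calc _ ≤ 2 * (p : ℝ) * Real.log p := hmain.trans hF
    _ = 2 * (√(p : ℝ) * √(p : ℝ)) * Real.log p := by rw [Real.mul_self_sqrt hp0.le]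
    _ = _ := by ring

end PolyaVinogradov

section Averages

variable {p : ℕ} [hp : Fact p.Prime]

/-- The largest `a` with `a ^ 2 * b ^ 3 ≤ x`. -/
noncomputable def sqBound (x : ℝ) (b : ℕ) : ℕ := ⌊√(x / (b : ℝ) ^ 3)⌋₊

lemma charSum_one_eq (χ : DirichletCharacter ℂ p) (N : ℕ) :
    charSum χ 1 N = charSum χ 0 (N + 1) := by
  have h0 : χ (0 : ZMod p) = 0 := MulChar.map_zero χ
  simp only [charSum, Finset.sum_range_succ', zero_add, Nat.cast_zero, h0, add_zero, add_comm]

lemma one_le_log_mul {x : ℝ} (hx : 2 ≤ x) : 1 ≤ 1.5 * Real.log x := by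
  have := Real.log_le_log (by norm_num) hx
  linarith [Real.log_two_gt_d9]

lemma sum_inv_Ioc_floor_le (Y : ℝ) (hY : 1 ≤ Y) :
    ∑ b ∈ Finset.Ioc 0 ⌊Y⌋₊, (b : ℝ)⁻¹ ≤ 1 + Real.log Y := by
  have h := harmonic_floor_le_one_add_log Y hY
  rw [harmonic_eq_sum_Icc] at h
  push_cast at h
  exact h

lemma sq_sqBound_le (X : ℝ) (hX : 0 ≤ X) (b : ℕ) :
    (sqBound (X ^ 3) b : ℝ) ^ 2 ≤ (X / b) ^ 3 := by
  have h1 : (sqBound (X ^ 3) b : ℝ) ≤ √(X ^ 3 / (b : ℝ) ^ 3) := Nat.floor_le (by positivity)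
  calc (sqBound (X ^ 3) b : ℝ) ^ 2 ≤ √(X ^ 3 / (b : ℝ) ^ 3) ^ 2 := by gcongr
    _ = X ^ 3 / (b : ℝ) ^ 3 := Real.sq_sqrt (by positivity)
    _ = _ := by rw [div_pow]

open Classical in
lemma sum_sum_norm_charSum_le (e k : ℕ) (hek : e * k = p - 1) (hp3 : 3 ≤ p) (x X : ℝ)
    (hx : 2 ≤ x) (hX0 : 0 ≤ X) (hX : X ^ 3 = x) :
    ∑ χ : DirichletCharacter ℂ p with χ ^ e = 1 ∧ χ ≠ 1,
      ∑ b ∈ Finset.Ioc 0 ⌊X⌋₊, ‖charSum χ 1 (sqBound x b)‖ ≤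
      e * (62 * X * Real.log x * ((p : ℝ) ^ (1 / 9 : ℝ) * Real.log p ^ (1 / 6 : ℝ))) := by
  set H := Finset.univ.filter fun χ : DirichletCharacter ℂ p => χ ^ e = 1 ∧ χ ≠ 1 with hH
  have hHe : (H.card : ℝ) ≤ e := card_nontrivial_pow_eq_one_le e k hek
  have hlog : 1 ≤ Real.log p := one_le_log_of_three_le hp3
  have hlogx : 1 ≤ 1.5 * Real.log x := one_le_log_mul hx
  have hp1 : (1 : ℝ) ≤ p := by exact_mod_cast (by omega : 1 ≤ p)
  have hX1 : 1 ≤ X := by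
    by_contra! h
    have : X ^ 3 ≤ 1 := pow_le_one₀ hX0 h.le
    linarith
  set P : ℝ := (p : ℝ) ^ (1 / 18 : ℝ) with hP
  have hP1 : 1 ≤ P := Real.one_le_rpow hp1 (by norm_num)
  have hP18 : P ^ 18 = p := by
    rw [hP, ← Real.rpow_natCast, ← Real.rpow_mul (by positivity)]; norm_num
  have hP2 : (p : ℝ) ^ (1 / 9 : ℝ) = P ^ 2 := by
    rw [hP, ← Real.rpow_natCast, ← Real.rpow_mul (by positivity)]; norm_num
  have hPs : √(p : ℝ) = P ^ 9 := by
    rw [Real.sqrt_eq_iff_mul_self_eq (by positivity) (by positivity), ← hP18]; ring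
  rw [hP2]
  set l : ℝ := Real.log p ^ (1 / 6 : ℝ) with hl
  have hl1 : 1 ≤ l := Real.one_le_rpow hlog (by norm_num)
  let Bg : ℕ → Prop := fun b => P ^ 7 * b ≤ X
  have hterm : ∀ b ∈ Finset.Ioc 0 ⌊X⌋₊, ∑ χ ∈ H, ‖charSum χ 1 (sqBound x b)‖ ≤
      30 * e * (P ^ 2 * l) * X * (b : ℝ)⁻¹ +
        if Bg b then e * (2 * P ^ 9 * Real.log x) else 0 := by
    intro b hb
    rw [Finset.mem_Ioc] at hb
    have hb0 : (0 : ℝ) < b := by exact_mod_cast hb.1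
    have hsq : (sqBound x b : ℝ) ^ 2 ≤ (X / b) ^ 3 := by
      rw [← hX]; exact sq_sqBound_le X hX0 b
    have hif : 0 ≤ if Bg b then e * (2 * P ^ 9 * Real.log x) else 0 := by
      have : 0 ≤ Real.log x := by linarith
      split_ifs <;> positivity
    by_cases hN : sqBound x b ^ 12 ≤ p ^ 7
    · have h1 := sum_norm_charSum_le e k hek hp3 (sqBound x b) hN 1
      rw [hP2, ← hH] at h1
      have h2 : (sqBound x b : ℝ) ^ (2 / 3 : ℝ) ≤ X * (b : ℝ)⁻¹ := by
        refine le_of_pow_le_pow_left₀ (n := 3) (by norm_num) (by positivity) ?_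
        rw [← Real.rpow_natCast, ← Real.rpow_mul (by positivity), ← div_eq_mul_inv]
        norm_num
        exact_mod_cast hsq
      calc _ ≤ _ := h1
        _ ≤ 30 * e * (X * (b : ℝ)⁻¹) * (P ^ 2 * l) := by gcongr
        _ ≤ _ := by linarith
    · push Not at hN
      have h3 : P ^ 7 * b ≤ X := by
        rw [← le_div_iff₀ hb0]
        refine le_of_pow_le_pow_left₀ (n := 18) (by norm_num) (by positivity) ?_
        calc (P ^ 7) ^ 18 = (p : ℝ) ^ 7 := by rw [← hP18]; ring
          _ ≤ (sqBound x b : ℝ) ^ 12 := by exact_mod_cast hN.le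
          _ = ((sqBound x b : ℝ) ^ 2) ^ 6 := by ring
          _ ≤ ((X / b) ^ 3) ^ 6 := by gcongr
          _ = _ := by ring
      have hb1 : (1 : ℝ) ≤ b := by exact_mod_cast hb.1
      have h4 : (p : ℝ) ≤ x := by
        rw [← hP18, ← hX]
        have h5 : P ^ 7 ≤ X := (le_mul_of_one_le_right (by positivity) hb1).trans h3
        calc P ^ 18 ≤ P ^ 21 := pow_le_pow_right₀ hP1 (by norm_num)
          _ = (P ^ 7) ^ 3 := by ring
          _ ≤ X ^ 3 := by gcongr
      have hll : Real.log p ≤ Real.log x := Real.log_le_log (by linarith) h4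
      rw [if_pos h3]
      have h6 : ∑ χ ∈ H, ‖charSum χ 1 (sqBound x b)‖ ≤ e * (2 * P ^ 9 * Real.log x) := by
        calc _ ≤ ∑ χ ∈ H, (2 * P ^ 9 * Real.log x) := by
              refine Finset.sum_le_sum fun χ hχ => ?_
              rw [charSum_one_eq]
              refine (norm_charSum_le_sqrt_mul_log hp3 χ (Finset.mem_filter.mp hχ).2.2 _).trans ?_
              rw [hPs]
              gcongr
          _ = H.card * (2 * P ^ 9 * Real.log x) := by rw [Finset.sum_const, nsmul_eq_mul]
          _ ≤ _ := by
              have : 0 ≤ Real.log x := by linarith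
              gcongr
      have : 0 ≤ 30 * e * (P ^ 2 * l) * X * (b : ℝ)⁻¹ := by positivity
      linarith
  have hcard : (((Finset.Ioc 0 ⌊X⌋₊).filter Bg).card : ℝ) * P ^ 7 ≤ X := by
    have h1 : ((Finset.Ioc 0 ⌊X⌋₊).filter Bg) ⊆ Finset.Ioc 0 ⌊X / P ^ 7⌋₊ := by
      intro b hb
      rw [Finset.mem_filter, Finset.mem_Ioc] at hb
      rw [Finset.mem_Ioc]
      refine ⟨hb.1.1, Nat.le_floor ?_⟩
      rw [le_div_iff₀ (by positivity), mul_comm]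
      exact hb.2
    have h2 := Finset.card_le_card h1
    rw [Nat.card_Ioc, Nat.sub_zero] at h2
    rw [← le_div_iff₀ (by positivity)]
    calc _ ≤ ((⌊X / P ^ 7⌋₊ : ℕ) : ℝ) := by exact_mod_cast h2
      _ ≤ _ := Nat.floor_le (by positivity)
  have hlogX : Real.log X ≤ 1 / 3 * Real.log x := by
    rw [← hX, Real.log_pow]
    push_cast
    linarith
  have hlx0 : 0 ≤ Real.log x := by linarith
  rw [Finset.sum_comm]
  calc _ ≤ ∑ b ∈ Finset.Ioc 0 ⌊X⌋₊, (30 * e * (P ^ 2 * l) * X * (b : ℝ)⁻¹ +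
        if Bg b then e * (2 * P ^ 9 * Real.log x) else 0) := Finset.sum_le_sum hterm
    _ = 30 * e * (P ^ 2 * l) * X * ∑ b ∈ Finset.Ioc 0 ⌊X⌋₊, (b : ℝ)⁻¹ +
        ((Finset.Ioc 0 ⌊X⌋₊).filter Bg).card * P ^ 7 * (e * (2 * P ^ 2 * Real.log x)) := by
        rw [Finset.sum_add_distrib, ← Finset.mul_sum, ← Finset.sum_filter, Finset.sum_const,
          nsmul_eq_mul]
        ring
    _ ≤ 30 * e * (P ^ 2 * l) * X * (2 * Real.log x) + X * (e * (2 * P ^ 2 * Real.log x)) := by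
        gcongr
        have := sum_inv_Ioc_floor_le X hX1
        linarith
    _ = 60 * e * (P ^ 2 * l) * X * Real.log x + X * (e * (2 * P ^ 2 * Real.log x)) * 1 := by ring
    _ ≤ 60 * e * (P ^ 2 * l) * X * Real.log x + X * (e * (2 * P ^ 2 * Real.log x)) * l := by
        gcongr
    _ = _ := by ring

end Averages

section Weights

lemma sum_powerset_superset {α : Type*} [DecidableEq α] (Q D : Finset α) (hD : D ⊆ Q)
    (f g : α → ℝ) :
    ∑ T ∈ Q.powerset, (if D ⊆ T then (∏ q ∈ T, f q) * ∏ q ∈ Q \ T, g q else 0) =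
      (∏ q ∈ D, f q) * ∏ q ∈ Q \ D, (f q + g q) := by
  have h1 := Finset.prod_add f (fun q => if q ∈ D then 0 else g q) Q
  rw [← Finset.prod_sdiff hD, mul_comm] at h1
  have h2 : ∏ q ∈ D, (f q + if q ∈ D then 0 else g q) = ∏ q ∈ D, f q :=
    Finset.prod_congr rfl fun q hq => by simp [hq]
  have h3 : ∏ q ∈ Q \ D, (f q + if q ∈ D then 0 else g q) = ∏ q ∈ Q \ D, (f q + g q) :=
    Finset.prod_congr rfl fun q hq => by simp [(Finset.mem_sdiff.mp hq).2]
  rw [← h2, ← h3, h1]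
  refine Finset.sum_congr rfl fun T hT => ?_
  split_ifs with h
  · congr 1
    refine Finset.prod_congr rfl fun q hq => ?_
    rw [if_neg fun hqD => (Finset.mem_sdiff.mp hq).2 (h hqD)]
  · obtain ⟨q, hqD, hqT⟩ := Finset.not_subset.mp h
    rw [Finset.prod_eq_zero (i := q) (Finset.mem_sdiff.mpr ⟨hD hqD, hqT⟩) (by simp [hqD]),
      mul_zero]

lemma pow_prod_eq_one_iff {G : Type*} [Monoid G] (g : G) (T : Finset ℕ)
    (hT : ∀ q ∈ T, q.Prime) :
    g ^ (∏ q ∈ T, q) = 1 ↔ Squarefree (orderOf g) ∧ (orderOf g).primeFactors ⊆ T := by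
  rw [← orderOf_dvd_iff_pow_eq_one]
  have hne : ∏ q ∈ T, q ≠ 0 := Finset.prod_ne_zero_iff.mpr fun q hq => (hT q hq).ne_zero
  constructor
  · intro h
    refine ⟨?_, ?_⟩
    · refine Squarefree.squarefree_of_dvd h ?_
      refine Finset.squarefree_prod_of_pairwise_isCoprime ?_ fun q hq => (hT q hq).prime.squarefree
      intro a ha b hb hab
      exact Nat.coprime_iff_isRelPrime.mp ((Nat.coprime_primes (hT a ha) (hT b hb)).mpr hab)
    · have := Nat.primeFactors_mono h hne
      rwa [Nat.primeFactors_prod hT] at this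
  · rintro ⟨hs, hD⟩
    rw [← Nat.prod_primeFactors_of_squarefree hs]
    exact Finset.prod_dvd_prod_of_subset _ _ _ hD

lemma prod_primes_dvd_pred {n : ℕ} (T : Finset ℕ) (hT : T ⊆ n.primeFactors) :
    ∏ q ∈ T, q ∣ n :=
  (Finset.prod_dvd_prod_of_subset _ _ _ hT).trans (Nat.prod_primeFactors_dvd n)

/-- The density `φ(n) / n` written as a product over prime divisors. -/
noncomputable def density (n : ℕ) : ℝ := ∏ q ∈ n.primeFactors, (1 - (q : ℝ)⁻¹)

lemma density_eq (n : ℕ) (hn : n ≠ 0) : (n.totient : ℝ) / n = density n := by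
  have h := congrArg (fun r : ℚ => (r : ℝ)) (Nat.totient_eq_mul_prod_factors n)
  simp only [Rat.cast_natCast, Rat.cast_mul, Rat.cast_prod, Rat.cast_sub, Rat.cast_one,
    Rat.cast_inv] at h
  rw [h, density, mul_comm, mul_div_assoc, div_self (by exact_mod_cast hn), mul_one]

lemma density_nonneg (n : ℕ) : 0 ≤ density n := by
  refine Finset.prod_nonneg fun q hq => ?_
  have : (1 : ℝ) ≤ q := by exact_mod_cast (Nat.prime_of_mem_primeFactors hq).one_lt.le
  linarith [inv_le_one_of_one_le₀ this]

open Classical in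
/-- The coefficient of a group element in the expansion of the primitive root indicator. -/
noncomputable def weight {G : Type*} [Monoid G] (n : ℕ) (g : G) : ℝ :=
  ∑ T ∈ n.primeFactors.powerset,
    if g ^ (∏ q ∈ T, q) = 1 then ∏ q ∈ T, (-(q : ℝ)⁻¹) else 0

/-- Nonnegative coefficients dominating `weight`. -/
noncomputable def majorant (n : ℕ) (T : Finset ℕ) : ℝ :=
  (∏ q ∈ T, ((q : ℝ) - 1)⁻¹) * ∏ q ∈ n.primeFactors \ T, (((q : ℝ) - 2) / ((q : ℝ) - 1))

lemma majorant_nonneg (n : ℕ) (T : Finset ℕ) (hT : T ⊆ n.primeFactors) : 0 ≤ majorant n T := by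
  have h2 : ∀ q ∈ n.primeFactors, (2 : ℝ) ≤ q := fun q hq => by
    exact_mod_cast (Nat.prime_of_mem_primeFactors hq).two_le
  refine mul_nonneg (Finset.prod_nonneg fun q hq => ?_) (Finset.prod_nonneg fun q hq => ?_)
  · have := h2 q (hT hq)
    exact inv_nonneg.mpr (by linarith)
  · have := h2 q (Finset.mem_sdiff.mp hq).1
    exact div_nonneg (by linarith) (by linarith)

lemma sum_prod_mul_majorant (n : ℕ) :
    ∑ T ∈ n.primeFactors.powerset, ((∏ q ∈ T, q : ℕ) : ℝ) * majorant n T =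
      2 ^ n.primeFactors.card := by
  have h := Finset.prod_add (fun q : ℕ => (q : ℝ) * ((q : ℝ) - 1)⁻¹)
    (fun q : ℕ => ((q : ℝ) - 2) / ((q : ℝ) - 1)) n.primeFactors
  have h1 : ∏ q ∈ n.primeFactors, ((q : ℝ) * ((q : ℝ) - 1)⁻¹ + ((q : ℝ) - 2) / ((q : ℝ) - 1)) =
      2 ^ n.primeFactors.card := by
    rw [Finset.prod_congr rfl (g := fun _ => (2 : ℝ)), Finset.prod_const]
    intro q hq
    have : (2 : ℝ) ≤ q := by exact_mod_cast (Nat.prime_of_mem_primeFactors hq).two_le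
    have h0 : (q : ℝ) - 1 ≠ 0 := by linarith
    field_simp
    ring
  rw [← h1, h]
  refine Finset.sum_congr rfl fun T _ => ?_
  rw [majorant, Finset.prod_mul_distrib]
  push_cast
  ring

open Classical in
lemma abs_weight_le {G : Type*} [Monoid G] (n : ℕ) (hn : n ≠ 0) (g : G) (hg : g ^ n = 1) :
    |weight n g| ≤ density n * ∑ T ∈ n.primeFactors.powerset,
      if g ^ (∏ q ∈ T, q) = 1 then majorant n T else 0 := by
  have hpr : ∀ T ∈ n.primeFactors.powerset, ∀ q ∈ T, q.Prime := fun T hT q hq =>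
    Nat.prime_of_mem_primeFactors (Finset.mem_powerset.mp hT hq)
  have h2 : ∀ q ∈ n.primeFactors, (2 : ℝ) ≤ q := fun q hq => by
    exact_mod_cast (Nat.prime_of_mem_primeFactors hq).two_le
  by_cases hs : Squarefree (orderOf g)
  · set D := (orderOf g).primeFactors
    have hD : D ⊆ n.primeFactors := Nat.primeFactors_mono (orderOf_dvd_of_pow_eq_one hg) hn
    have hw : weight n g = (∏ q ∈ D, (-(q : ℝ)⁻¹)) *
        ∏ q ∈ n.primeFactors \ D, (-(q : ℝ)⁻¹ + 1) := by
      rw [← sum_powerset_superset _ _ hD, weight]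
      refine Finset.sum_congr rfl fun T hT => ?_
      simp [pow_prod_eq_one_iff g T (hpr T hT), hs, D]
    have hm : ∑ T ∈ n.primeFactors.powerset,
        (if g ^ (∏ q ∈ T, q) = 1 then majorant n T else 0) = ∏ q ∈ D, ((q : ℝ) - 1)⁻¹ := by
      have := sum_powerset_superset _ _ hD (fun q : ℕ => ((q : ℝ) - 1)⁻¹)
        (fun q : ℕ => ((q : ℝ) - 2) / ((q : ℝ) - 1))
      rw [Finset.prod_eq_one (s := n.primeFactors \ D), mul_one] at this
      · rw [← this]
        refine Finset.sum_congr rfl fun T hT => ?_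
        simp [pow_prod_eq_one_iff g T (hpr T hT), hs, D, majorant]
      · intro q hq
        have := h2 q (Finset.mem_sdiff.mp hq).1
        have h0 : (q : ℝ) - 1 ≠ 0 := by linarith
        field_simp
        ring
    rw [hm, hw, density, ← Finset.prod_sdiff hD, mul_assoc, ← Finset.prod_mul_distrib, abs_mul,
      Finset.abs_prod, Finset.abs_prod, mul_comm]
    apply le_of_eq
    congr 1
    · refine Finset.prod_congr rfl fun q hq => ?_
      have := h2 q (Finset.mem_sdiff.mp hq).1
      have : (q : ℝ)⁻¹ ≤ 1 := inv_le_one_of_one_le₀ (by linarith)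
      rw [abs_of_nonneg (by linarith)]
      ring
    · refine Finset.prod_congr rfl fun q hq => ?_
      have := h2 q (hD hq)
      have h0 : (q : ℝ) - 1 ≠ 0 := by linarith
      have h0 : (q : ℝ) ≠ 0 := by linarith
      rw [abs_neg, abs_of_nonneg (by positivity)]
      field_simp
  · have hw : weight n g = 0 := by
      rw [weight]
      refine Finset.sum_eq_zero fun T hT => ?_
      simp [pow_prod_eq_one_iff g T (hpr T hT), hs]
    rw [hw, abs_zero]
    refine mul_nonneg (density_nonneg n) (Finset.sum_nonneg fun T hT => ?_)
    split_ifs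
    · exact majorant_nonneg n T (Finset.mem_powerset.mp hT)
    · exact le_rfl

lemma weight_one {G : Type*} [Monoid G] (n : ℕ) : weight n (1 : G) = density n := by
  have h := sum_powerset_superset n.primeFactors ∅ (Finset.empty_subset _)
    (fun q : ℕ => -(q : ℝ)⁻¹) (fun _ => 1)
  simp only [Finset.empty_subset, if_true, Finset.prod_const_one, mul_one, Finset.prod_empty,
    one_mul, Finset.sdiff_empty] at h
  simp only [weight, one_pow, if_true, density]
  rw [h]
  exact Finset.prod_congr rfl fun q _ => by ring

lemma weight_of_orderOf_eq_two {G : Type*} [Monoid G] (n : ℕ) (hn : n ≠ 0) (hn2 : 2 ∣ n) (g : G)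
    (hg : orderOf g = 2) : weight n g = -density n := by
  classical
  have hD : ({2} : Finset ℕ) ⊆ n.primeFactors := by
    rw [Finset.singleton_subset_iff, Nat.mem_primeFactors]
    exact ⟨Nat.prime_two, hn2, hn⟩
  have h := sum_powerset_superset n.primeFactors {2} hD
    (fun q : ℕ => -(q : ℝ)⁻¹) (fun _ => 1)
  have hw : weight n g = (∏ q ∈ ({2} : Finset ℕ), (-(q : ℝ)⁻¹)) *
        ∏ q ∈ n.primeFactors \ {2}, (-(q : ℝ)⁻¹ + 1) := by
      rw [← h, weight]
      refine Finset.sum_congr rfl fun T hT => ?_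
      rw [pow_prod_eq_one_iff g T fun q hq =>
        Nat.prime_of_mem_primeFactors (Finset.mem_powerset.mp hT hq), hg]
      simp [Nat.prime_two.prime.squarefree, Nat.Prime.primeFactors Nat.prime_two]
  rw [hw, density, ← Finset.prod_sdiff hD, Finset.prod_singleton, Finset.prod_singleton]
  simp only [neg_add_eq_sub]
  norm_num
  ring

end Weights

section Indicator

variable {p : ℕ} [hp : Fact p.Prime]

lemma sum_powerset_prod_dvd (n m : ℕ) (hmn : m ∣ n) (hn : n ≠ 0) :
    ∑ T ∈ n.primeFactors.powerset, (if ∏ q ∈ T, q ∣ m then ((-1) ^ T.card : ℂ) else 0) =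
      if m = 1 then 1 else 0 := by
  have h := Finset.prod_add (fun q : ℕ => if q ∣ m then (-1 : ℂ) else 0) (fun _ => 1) n.primeFactors
  have h1 : ∀ T ∈ n.primeFactors.powerset,
      (∏ q ∈ T, (if q ∣ m then (-1 : ℂ) else 0)) * ∏ q ∈ n.primeFactors \ T, (1 : ℂ) =
      if ∏ q ∈ T, q ∣ m then ((-1) ^ T.card : ℂ) else 0 := by
    intro T hT
    rw [Finset.prod_const_one, mul_one]
    split_ifs with hd
    · rw [Finset.prod_congr rfl fun q hq => if_pos ((Finset.dvd_prod_of_mem _ hq).trans hd),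
        Finset.prod_const]
    · by_contra h0
      refine hd (Finset.prod_primes_dvd m (fun q hq =>
        (Nat.prime_of_mem_primeFactors (Finset.mem_powerset.mp hT hq)).prime) fun q hq => ?_)
      by_contra hqm
      exact h0 (Finset.prod_eq_zero hq (if_neg hqm))
  rw [Finset.sum_congr rfl h1] at h
  rw [← h]
  split_ifs with hm
  · refine Finset.prod_eq_one fun q hq => ?_
    have := (Nat.prime_of_mem_primeFactors hq).one_lt
    rw [hm, if_neg (by rw [Nat.dvd_one]; omega), zero_add]
  · obtain ⟨q, hq, hqm⟩ := Nat.exists_prime_and_dvd hm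
    refine Finset.prod_eq_zero (i := q) ?_ (by simp [hqm])
    exact Nat.mem_primeFactors.mpr ⟨hq, hqm.trans hmn, hn⟩

open Classical in
lemma sum_weight_mul_apply (u : ZMod p) :
    ∑ χ : DirichletCharacter ℂ p, (weight (p - 1) χ : ℂ) * χ u =
      if orderOf u = p - 1 then 1 else 0 := by
  have hp1 : p - 1 ≠ 0 := by have := hp.out.one_lt; omega
  by_cases hu : u = 0
  · subst hu
    have h0 : orderOf (0 : ZMod p) = 0 := by
      rw [orderOf_eq_zero_iff']
      intro n hn
      rw [zero_pow hn.ne']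
      exact zero_ne_one
    rw [h0, if_neg hp1.symm]
    exact Finset.sum_eq_zero fun χ _ => by rw [MulChar.map_zero, mul_zero]
  obtain ⟨m, hm⟩ : orderOf u ∣ p - 1 := orderOf_dvd_of_pow_eq_one (ZMod.pow_card_sub_one_eq_one hu)
  have hd0 : 0 < orderOf u := Nat.pos_of_ne_zero fun h => hp1 (by rw [hm, h, zero_mul])
  have hind : (orderOf u = p - 1) ↔ m = 1 := by
    rw [hm]
    constructor
    · intro h
      exact (Nat.eq_of_mul_eq_mul_left hd0 (by rw [mul_one]; exact h)).symm
    · rintro rfl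
      rw [mul_one]
  rw [if_congr hind rfl rfl, ← sum_powerset_prod_dvd (p - 1) m (Dvd.intro_left _ hm.symm) hp1]
  simp only [weight, Complex.ofReal_sum, Finset.sum_mul]
  rw [Finset.sum_comm]
  refine Finset.sum_congr rfl fun T hT => ?_
  have hTs := Finset.mem_powerset.mp hT
  obtain ⟨k, hk⟩ := prod_primes_dvd_pred T hTs
  have he0 : ∏ q ∈ T, q ≠ 0 := fun h => hp1 (by rw [hk, h, zero_mul])
  have h1 := sum_pow_eq_one_apply (∏ q ∈ T, q) k hk.symm u hu
  have h2 : u ^ k = 1 ↔ ∏ q ∈ T, q ∣ m := by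
    rw [← orderOf_dvd_iff_pow_eq_one]
    constructor
    · rintro ⟨j, rfl⟩
      refine ⟨j, Nat.eq_of_mul_eq_mul_left hd0 ?_⟩
      rw [← hm, hk]; ring
    · rintro ⟨j, rfl⟩
      refine ⟨j, Nat.eq_of_mul_eq_mul_left (Nat.pos_of_ne_zero he0) ?_⟩
      rw [← hk, hm]; ring
  rw [if_congr h2 rfl rfl, Finset.sum_filter] at h1
  calc _ = ((∏ q ∈ T, (-(q : ℝ)⁻¹) : ℝ) : ℂ) * ∑ χ : DirichletCharacter ℂ p,
        (if χ ^ (∏ q ∈ T, q) = 1 then χ u else 0) := by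
        rw [Finset.mul_sum]
        refine Finset.sum_congr rfl fun χ _ => ?_
        split_ifs <;> simp
    _ = _ := by
        rw [h1]
        split_ifs
        · push_cast
          rw [← Finset.prod_mul_distrib, Finset.prod_congr rfl (g := fun _ => (-1 : ℂ)),
            Finset.prod_const]
          intro q hq
          have : (q : ℂ) ≠ 0 := by
            exact_mod_cast (Nat.prime_of_mem_primeFactors (hTs hq)).ne_zero
          field_simp
        · rw [mul_zero]

open Classical in
lemma sum_comp_sq_le (S : Finset (DirichletCharacter ℂ p)) (W : DirichletCharacter ℂ p → ℝ)
    (hW : ∀ χ, 0 ≤ W χ) (H : Finset (DirichletCharacter ℂ p)) (hS : ∀ χ ∈ S, χ ^ 2 ∈ H) :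
    ∑ χ ∈ S, W (χ ^ 2) ≤ 2 * ∑ ψ ∈ H, W ψ := by
  have := isCyclic_dirichletCharacter (p := p)
  rw [← Finset.sum_fiberwise_of_maps_to hS, Finset.mul_sum]
  refine Finset.sum_le_sum fun ψ _ => ?_
  have hcard : ((S.filter fun χ => χ ^ 2 = ψ).card : ℝ) ≤ 2 := by
    have h2 : (Finset.univ.filter fun χ : DirichletCharacter ℂ p => χ ^ 2 = 1).card ≤ 2 :=
      IsCyclic.card_pow_eq_one_le (by norm_num)
    rcases (S.filter fun χ => χ ^ 2 = ψ).eq_empty_or_nonempty with h | ⟨χ₀, h0⟩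
    · rw [h]; norm_num
    · have h3 : (S.filter fun χ => χ ^ 2 = ψ).card ≤
          (Finset.univ.filter fun χ : DirichletCharacter ℂ p => χ ^ 2 = 1).card := by
        refine Finset.card_le_card_of_injOn (fun χ => χ * χ₀⁻¹) ?_ ?_
        · intro χ hχ
          have h4 := (Finset.mem_filter.mp hχ).2
          have h5 := (Finset.mem_filter.mp h0).2
          simp [mul_pow, inv_pow, h4, h5]
        · intro a _ b _ hab
          exact mul_right_cancel hab
      exact_mod_cast h3.trans h2
  calc _ = ((S.filter fun χ => χ ^ 2 = ψ).card : ℝ) * W ψ := by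
        rw [Finset.sum_congr rfl fun χ hχ => by rw [(Finset.mem_filter.mp hχ).2],
          Finset.sum_const, nsmul_eq_mul]
    _ ≤ _ := mul_le_mul_of_nonneg_right hcard (hW ψ)

open Classical in
lemma sum_abs_weight_mul_le (W : DirichletCharacter ℂ p → ℝ) (hW : ∀ χ, 0 ≤ W χ) (B : ℝ)
    (hB : ∀ e k, e * k = p - 1 →
      ∑ χ : DirichletCharacter ℂ p with χ ^ e = 1 ∧ χ ≠ 1, W χ ≤ e * B) :
    ∑ χ : DirichletCharacter ℂ p with χ ^ 2 ≠ 1, |weight (p - 1) χ| * W (χ ^ 2) ≤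
      density (p - 1) * 2 ^ (p - 1).primeFactors.card * (2 * B) := by
  have hp1 : p - 1 ≠ 0 := by have := hp.out.one_lt; omega
  calc _ ≤ ∑ χ : DirichletCharacter ℂ p with χ ^ 2 ≠ 1, density (p - 1) *
        ∑ T ∈ (p - 1).primeFactors.powerset,
          (if χ ^ (∏ q ∈ T, q) = 1 then majorant (p - 1) T * W (χ ^ 2) else 0) := by
        refine Finset.sum_le_sum fun χ _ => ?_
        refine (mul_le_mul_of_nonneg_right
          (abs_weight_le (p - 1) hp1 χ (dirichletCharacter_pow_card χ)) (hW _)).trans_eq ?_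
        rw [mul_assoc, Finset.sum_mul]
        congr 1
        exact Finset.sum_congr rfl fun T _ => by split_ifs <;> simp
    _ = density (p - 1) * ∑ T ∈ (p - 1).primeFactors.powerset, majorant (p - 1) T *
          ∑ χ : DirichletCharacter ℂ p with χ ^ 2 ≠ 1 ∧ χ ^ (∏ q ∈ T, q) = 1, W (χ ^ 2) := by
        rw [← Finset.mul_sum, Finset.sum_comm]
        congr 1
        refine Finset.sum_congr rfl fun T _ => ?_
        rw [Finset.mul_sum, ← Finset.filter_filter, ← Finset.sum_filter]
    _ ≤ density (p - 1) * ∑ T ∈ (p - 1).primeFactors.powerset, majorant (p - 1) T *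
          (((∏ q ∈ T, q : ℕ) : ℝ) * (2 * B)) := by
        refine mul_le_mul_of_nonneg_left ?_ (density_nonneg _)
        refine Finset.sum_le_sum fun T hT => ?_
        have hTs := Finset.mem_powerset.mp hT
        refine mul_le_mul_of_nonneg_left ?_ (majorant_nonneg _ _ hTs)
        obtain ⟨k, hk⟩ := prod_primes_dvd_pred T hTs
        refine (sum_comp_sq_le _ W hW
          (Finset.univ.filter fun χ => χ ^ (∏ q ∈ T, q) = 1 ∧ χ ≠ 1) ?_).trans ?_
        · intro χ hχ
          obtain ⟨-, h1, h2⟩ := Finset.mem_filter.mp hχ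
          refine Finset.mem_filter.mpr ⟨Finset.mem_univ _, ?_, h1⟩
          rw [← pow_mul, mul_comm, pow_mul, h2, one_pow]
        · have := hB _ k hk.symm
          linarith
    _ = _ := by
        rw [← sum_prod_mul_majorant]
        simp only [Finset.sum_mul, Finset.mul_sum]
        exact Finset.sum_congr rfl fun T _ => by ring

end Indicator

section Parametrization

lemma squarefree_eq_of_sq_mul_eq {b b' s s' : ℕ} (hb : Squarefree b) (hb' : Squarefree b')
    (hs : s ≠ 0) (hs' : s' ≠ 0) (h : s ^ 2 * b = s' ^ 2 * b') : b = b' := by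
  refine Nat.eq_of_factorization_eq hb.ne_zero hb'.ne_zero fun q => ?_
  have h1 := congrArg (fun n => n.factorization q) h
  simp only [Nat.factorization_mul (pow_ne_zero 2 hs) hb.ne_zero,
    Nat.factorization_mul (pow_ne_zero 2 hs') hb'.ne_zero, Nat.factorization_pow,
    Finsupp.add_apply, Finsupp.smul_apply, smul_eq_mul] at h1
  have h2 := hb.natFactorization_le_one q
  have h3 := hb'.natFactorization_le_one q
  omega

lemma squarefull_sq_mul_cube (a b : ℕ) : Squarefull (a ^ 2 * b ^ 3) := by
  intro q hq hd
  rcases hq.dvd_mul.mp hd with h | h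
  · exact (pow_dvd_pow_of_dvd (hq.dvd_of_dvd_pow h) 2).trans (Dvd.intro _ rfl)
  · exact (pow_dvd_pow_of_dvd (hq.dvd_of_dvd_pow h) 2).trans
      ((pow_dvd_pow b (by norm_num)).trans (Dvd.intro_left _ rfl))

lemma exists_sq_mul_cube {m : ℕ} (hm : Squarefull m) (hm0 : m ≠ 0) :
    ∃ a b : ℕ, Squarefree b ∧ a ≠ 0 ∧ a ^ 2 * b ^ 3 = m := by
  obtain ⟨b, s, hbs, hb⟩ := Nat.sq_mul_squarefree m
  have hdvd : b ∣ s := by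
    rw [← Nat.prod_primeFactors_of_squarefree hb]
    refine Finset.prod_primes_dvd s (fun q hq => (Nat.prime_of_mem_primeFactors hq).prime)
      fun q hq => ?_
    have hqp := Nat.prime_of_mem_primeFactors hq
    by_contra hqs
    have h1 : q ^ 2 ∣ s ^ 2 * b := by
      rw [hbs]
      exact hm q hqp ((Nat.dvd_of_mem_primeFactors hq).trans (Dvd.intro_left _ hbs))
    have h2 : q ^ 2 ∣ b :=
      (Nat.Coprime.pow 2 2 ((Nat.Prime.coprime_iff_not_dvd hqp).mpr hqs)).dvd_of_dvd_mul_left h1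
    rw [pow_two] at h2
    exact hqp.one_lt.ne' (Nat.isUnit_iff.mp (hb q h2))
  obtain ⟨a, rfl⟩ := hdvd
  refine ⟨a, b, hb, ?_, by rw [← hbs]; ring⟩
  rintro rfl
  apply hm0
  rw [← hbs]
  ring

lemma sq_mul_cube_le_iff {x : ℝ} (hx : 0 ≤ x) {a b : ℕ} (hb : 0 < b) :
    a ^ 2 * b ^ 3 ≤ ⌊x⌋₊ ↔ a ≤ sqBound x b := by
  have hb' : (0 : ℝ) < (b : ℝ) ^ 3 := by positivity
  rw [sqBound, Nat.le_floor_iff hx, Nat.le_floor_iff (Real.sqrt_nonneg _),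
    Real.le_sqrt (Nat.cast_nonneg a) (by positivity), le_div_iff₀ hb']
  push_cast
  rfl

open Classical in
lemma sum_squarefull (x X : ℝ) (hX0 : 0 ≤ X) (hX : X ^ 3 = x) {M : Type*} [AddCommMonoid M]
    (f : ℕ → M) :
    ∑ m ∈ Finset.Icc 1 ⌊x⌋₊ with Squarefull m, f m =
      ∑ b ∈ Finset.Ioc 0 ⌊X⌋₊ with Squarefree b,
        ∑ a ∈ Finset.Ioc 0 (sqBound x b), f (a ^ 2 * b ^ 3) := by
  have hx0 : 0 ≤ x := by rw [← hX]; positivity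
  rw [Finset.sum_sigma']
  symm
  refine Finset.sum_bij (fun t _ => t.2 ^ 2 * t.1 ^ 3) ?_ ?_ ?_ fun _ _ => rfl
  · rintro ⟨b, a⟩ h
    simp only [Finset.mem_sigma, Finset.mem_filter, Finset.mem_Ioc] at h
    obtain ⟨⟨⟨hb0, hbX⟩, hb⟩, ha0, ha⟩ := h
    simp only [Finset.mem_filter, Finset.mem_Icc]
    refine ⟨⟨?_, (sq_mul_cube_le_iff hx0 hb0).mpr ha⟩, squarefull_sq_mul_cube a b⟩
    exact Nat.succ_le_of_lt (by positivity)
  · rintro ⟨b, a⟩ h ⟨b', a'⟩ h' heq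
    simp only [Finset.mem_sigma, Finset.mem_filter, Finset.mem_Ioc] at h h'
    have hbb : b = b' := by
      refine squarefree_eq_of_sq_mul_eq (s := a * b) (s' := a' * b') h.1.2 h'.1.2
        (mul_ne_zero h.2.1.ne' h.1.1.1.ne') (mul_ne_zero h'.2.1.ne' h'.1.1.1.ne') ?_
      simp only at heq
      calc _ = a ^ 2 * b ^ 3 := by ring
        _ = _ := by rw [heq]; ring
    subst hbb
    have h1 : a ^ 2 = a' ^ 2 := by
      have h2 : 0 < b ^ 3 := pow_pos h.1.1.1 3
      exact Nat.eq_of_mul_eq_mul_right h2 heq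
    have h2 : a = a' := Nat.pow_left_injective (n := 2) (by norm_num) h1
    rw [h2]
  · intro m hm
    simp only [Finset.mem_filter, Finset.mem_Icc] at hm
    obtain ⟨a, b, hb, ha0, hab⟩ := exists_sq_mul_cube hm.2 (by omega)
    have hb0 : 0 < b := Nat.pos_of_ne_zero hb.ne_zero
    refine ⟨⟨b, a⟩, ?_, hab⟩
    simp only [Finset.mem_sigma, Finset.mem_filter, Finset.mem_Ioc]
    refine ⟨⟨⟨hb0, Nat.le_floor ?_⟩, hb⟩, Nat.pos_of_ne_zero ha0,
      (sq_mul_cube_le_iff hx0 hb0).mp (by rw [hab]; exact hm.1.2)⟩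
    have h1 : b ^ 3 ≤ m := by
      rw [← hab]
      exact Nat.le_mul_of_pos_left _ (by positivity)
    have h2 : ((b : ℝ)) ^ 3 ≤ X ^ 3 := by
      rw [hX]
      calc (b : ℝ) ^ 3 ≤ m := by exact_mod_cast h1
        _ ≤ x := (Nat.le_floor_iff hx0).mp hm.1.2
    exact le_of_pow_le_pow_left₀ (by norm_num) hX0 h2

end Parametrization

section Quadratic

variable {p : ℕ} [hp : Fact p.Prime]

open Classical in
lemma sum_sq_eq_one_weight (hp2 : p ≠ 2) (u : ZMod p) :
    ∑ χ : DirichletCharacter ℂ p with χ ^ 2 = 1, (weight (p - 1) χ : ℂ) * χ u =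
      density (p - 1) * ((if u = 0 then 0 else 1) - (quadraticChar (ZMod p) u : ℂ)) := by
  have hp1 : p - 1 ≠ 0 := by have := hp.out.one_lt; omega
  have := isCyclic_dirichletCharacter (p := p)
  have hchar : ringChar (ZMod p) ≠ 2 := by rwa [ZMod.ringChar_zmod_n]
  set ψ : DirichletCharacter ℂ p := (quadraticChar (ZMod p)).ringHomComp (Int.castRingHom ℂ)
    with hψ
  have hψne : ψ ≠ 1 := by
    obtain ⟨a, ha⟩ := quadraticChar_exists_neg_one hchar
    intro h
    have h1 : ψ a = (-1 : ℂ) := by simp [hψ, ha]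
    have ha0 : IsUnit a := by
      rw [isUnit_iff_ne_zero]
      rintro rfl
      simp at ha
    rw [h, MulChar.one_apply ha0] at h1
    norm_num at h1
  have hψ2 : ψ ^ 2 = 1 := ((quadraticChar_isQuadratic (ZMod p)).comp _).sq_eq_one
  have hset : (Finset.univ.filter fun χ : DirichletCharacter ℂ p => χ ^ 2 = 1) = {1, ψ} := by
    symm
    refine Finset.eq_of_subset_of_card_le ?_ ?_
    · intro χ hχ
      rcases Finset.mem_insert.mp hχ with rfl | h
      · simp
      · rw [Finset.mem_singleton.mp h]; simp [hψ2]
    · rw [Finset.card_pair hψne.symm]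
      exact IsCyclic.card_pow_eq_one_le (by norm_num)
  have h2 : 2 ∣ p - 1 := by
    have := hp.out.eq_two_or_odd
    omega
  rw [hset, Finset.sum_pair hψne.symm, weight_one,
    weight_of_orderOf_eq_two _ hp1 h2 ψ (orderOf_eq_prime hψ2 hψne)]
  have h3 : ψ u = (quadraticChar (ZMod p) u : ℂ) := by simp [hψ]
  rw [h3]
  split_ifs with hu
  · rw [hu, MulChar.map_zero, MulChar.map_zero]; simp
  · rw [MulChar.one_apply (isUnit_iff_ne_zero.mpr hu)]
    push_cast
    ring

end Quadratic

section Reduction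

variable {p : ℕ} [hp : Fact p.Prime]

lemma charSum_sq_eq (χ : DirichletCharacter ℂ p) (b N : ℕ) :
    ∑ a ∈ Finset.Ioc 0 N, χ ((a ^ 2 * b ^ 3 : ℕ) : ZMod p) =
      χ ((b ^ 3 : ℕ) : ZMod p) * charSum (χ ^ 2) 1 N := by
  have hI : Finset.Ioc 0 N = Finset.Ico 1 (N + 1) := by ext; simp; omega
  rw [charSum, Finset.mul_sum, hI, Finset.sum_Ico_eq_sum_range, Nat.add_sub_cancel]
  refine Finset.sum_congr rfl fun a _ => ?_
  rw [Nat.cast_mul, map_mul, Nat.cast_pow (1 + a), map_pow, MulChar.pow_apply' _ two_ne_zero,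
    mul_comm]

open Classical in
lemma norm_sum_squarefull_le (χ : DirichletCharacter ℂ p) (x X : ℝ) (hX0 : 0 ≤ X)
    (hX : X ^ 3 = x) :
    ‖∑ m ∈ Finset.Icc 1 ⌊x⌋₊ with Squarefull m, χ (m : ZMod p)‖ ≤
      ∑ b ∈ Finset.Ioc 0 ⌊X⌋₊, ‖charSum (χ ^ 2) 1 (sqBound x b)‖ := by
  rw [sum_squarefull x X hX0 hX (fun m => χ (m : ZMod p))]
  refine (norm_sum_le _ _).trans ((Finset.sum_le_sum fun b _ => ?_).trans
    (Finset.sum_le_sum_of_subset_of_nonneg (Finset.filter_subset _ _) fun _ _ _ => norm_nonneg _))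
  rw [charSum_sq_eq, norm_mul]
  exact mul_le_of_le_one_left (norm_nonneg _) (DirichletCharacter.norm_le_one χ _)

open Classical in
lemma sum_real_characters (hp2 : p ≠ 2) (x X : ℝ) (hX0 : 0 ≤ X) (hX : X ^ 3 = x) :
    ∑ m ∈ Finset.Icc 1 ⌊x⌋₊ with Squarefull m,
      ∑ χ : DirichletCharacter ℂ p with χ ^ 2 = 1, (weight (p - 1) χ : ℂ) * χ (m : ZMod p) =
    ((2 * density (p - 1) * ∑ b ∈ Finset.Ioc 0 ⌊X⌋₊ with Squarefree b ∧ legendreSym p ((b : ℕ) : ℤ) = -1,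
      (((Finset.Ioc 0 (sqBound x b)).filter fun a => ¬ p ∣ a).card : ℝ) : ℝ) : ℂ) := by
  simp only [sum_sq_eq_one_weight hp2]
  rw [sum_squarefull x X hX0 hX, ← Finset.filter_filter, Finset.sum_filter (p := fun b => _ = _)]
  push_cast
  rw [Finset.mul_sum]
  refine Finset.sum_congr rfl fun b _ => ?_
  have hL : (legendreSym p (b : ℤ)) = quadraticChar (ZMod p) (b : ZMod p) := by
    simp [legendreSym]
  rw [hL]
  have key : ∀ a : ℕ, ((if ((a : ZMod p) ^ 2 * (b : ZMod p) ^ 3) = 0 then 0 else 1) -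
      (quadraticChar (ZMod p) ((a : ZMod p) ^ 2 * (b : ZMod p) ^ 3) : ℂ)) =
      if quadraticChar (ZMod p) (b : ZMod p) = -1 then (if ¬ p ∣ a then 2 else 0) else 0 := by
    intro a
    simp only [← ZMod.natCast_eq_zero_iff a p]
    rw [map_mul, map_pow, map_pow]
    by_cases ha : (a : ZMod p) = 0
    · simp [ha]
    by_cases hb : (b : ZMod p) = 0
    · simp [hb]
    rw [quadraticChar_sq_one ha]
    rcases quadraticChar_dichotomy hb with h | h
    · simp [ha, hb, h]
    · simp [ha, hb, h]; norm_num
  have key' : ∀ a : ℕ, (density (p - 1) : ℂ) *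
      ((if ((a : ZMod p) ^ 2 * (b : ZMod p) ^ 3) = 0 then 0 else 1) -
      (quadraticChar (ZMod p) ((a : ZMod p) ^ 2 * (b : ZMod p) ^ 3) : ℂ)) = _ :=
    fun a => congrArg (fun z => (density (p - 1) : ℂ) * z) (key a)
  rw [Finset.sum_congr rfl fun a _ => key' a]
  split_ifs
  · rw [← Finset.mul_sum, ← Finset.sum_filter, Finset.sum_const, nsmul_eq_mul]
    push_cast
    ring
  · simp

open Classical in
lemma abs_card_sub_le (hp3 : 3 ≤ p) (x X : ℝ) (hx : 2 ≤ x) (hX0 : 0 ≤ X) (hX : X ^ 3 = x) :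
    |(((Finset.Icc 1 ⌊x⌋₊).filter
        (fun m => Squarefull m ∧ orderOf (m : ZMod p) = p - 1)).card : ℝ) -
      2 * density (p - 1) * ∑ b ∈ Finset.Ioc 0 ⌊X⌋₊ with Squarefree b ∧ legendreSym p ((b : ℕ) : ℤ) = -1,
        (((Finset.Ioc 0 (sqBound x b)).filter fun a => ¬ p ∣ a).card : ℝ)| ≤
      density (p - 1) * 2 ^ (p - 1).primeFactors.card *
        (2 * (62 * X * Real.log x * ((p : ℝ) ^ (1 / 9 : ℝ) * Real.log p ^ (1 / 6 : ℝ)))) := by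
  have h1 : ((((Finset.Icc 1 ⌊x⌋₊).filter
        (fun m => Squarefull m ∧ orderOf (m : ZMod p) = p - 1)).card : ℝ) : ℂ) =
      ∑ m ∈ Finset.Icc 1 ⌊x⌋₊ with Squarefull m,
        ∑ χ : DirichletCharacter ℂ p, (weight (p - 1) χ : ℂ) * χ (m : ZMod p) := by
    simp only [sum_weight_mul_apply]
    rw [← Finset.filter_filter, ← Finset.sum_filter, Finset.sum_const, nsmul_eq_mul, mul_one]
    push_cast
    rfl
  have h2 : ∀ m : ℕ, ∑ χ : DirichletCharacter ℂ p, (weight (p - 1) χ : ℂ) * χ (m : ZMod p) =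
      ∑ χ : DirichletCharacter ℂ p with χ ^ 2 = 1, (weight (p - 1) χ : ℂ) * χ (m : ZMod p) +
      ∑ χ : DirichletCharacter ℂ p with χ ^ 2 ≠ 1, (weight (p - 1) χ : ℂ) * χ (m : ZMod p) :=
    fun m => (Finset.sum_filter_add_sum_filter_not _ _ _).symm
  simp only [h2] at h1
  rw [Finset.sum_add_distrib, sum_real_characters (by omega) x X hX0 hX, ← sub_eq_iff_eq_add',
    ← Complex.ofReal_sub] at h1
  rw [← Real.norm_eq_abs, ← Complex.norm_real, h1, Finset.sum_comm]
  refine (norm_sum_le _ _).trans ((Finset.sum_le_sum fun χ _ => ?_).trans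
    (sum_abs_weight_mul_le
      (fun ψ => ∑ b ∈ Finset.Ioc 0 ⌊X⌋₊, ‖charSum ψ 1 (sqBound x b)‖)
      (fun ψ => Finset.sum_nonneg fun _ _ => norm_nonneg _) _
      fun e k hek => sum_sum_norm_charSum_le e k hek hp3 x X hx hX0 hX))
  rw [← Finset.mul_sum, norm_mul, Complex.norm_real, Real.norm_eq_abs]
  exact mul_le_mul_of_nonneg_left (norm_sum_squarefull_le χ x X hX0 hX) (abs_nonneg _)

end Reduction

section MainTerm

lemma rpow_neg_three_halves (n : ℕ) : (n : ℝ) ^ (-(3 / 2 : ℝ)) = (√(n : ℝ) ^ 3)⁻¹ := by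
  rw [Real.rpow_neg (Nat.cast_nonneg n), Real.sqrt_eq_rpow, ← Real.rpow_natCast,
    ← Real.rpow_mul (Nat.cast_nonneg n)]
  norm_num

lemma inv_sqrt_cube_le (k : ℝ) (hk : 0 < k) :
    (√(k + 1) ^ 3)⁻¹ ≤ 2 / √k - 2 / √(k + 1) := by
  have hs : 0 < √k := Real.sqrt_pos.mpr hk
  have ht : 0 < √(k + 1) := Real.sqrt_pos.mpr (by linarith)
  have hs2 : √k ^ 2 = k := Real.sq_sqrt hk.le
  have ht2 : √(k + 1) ^ 2 = k + 1 := Real.sq_sqrt (by linarith)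
  have hst : √k ≤ √(k + 1) := Real.sqrt_le_sqrt (by linarith)
  set s := √k
  set t := √(k + 1)
  have h1 : (t - s) * (t + s) = 1 := by nlinarith
  have h2 : 2 / s - 2 / t = 2 / (s * t * (t + s)) := by
    have h3 : t + s ≠ 0 := by positivity
    field_simp
    linarith
  rw [h2, inv_eq_one_div, div_le_div_iff₀ (by positivity) (by positivity)]
  nlinarith [mul_le_mul_of_nonneg_left hst hs.le, mul_le_mul_of_nonneg_left hst ht.le,
    mul_le_mul_of_nonneg_left (show s * (t + s) ≤ 2 * t ^ 2 by nlinarith) ht.le]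

lemma tsum_tail_le (g : ℕ → ℝ) (hg0 : ∀ n, 0 ≤ g n)
    (hg : ∀ n : ℕ, g n ≤ (n : ℝ) ^ (-(3 / 2 : ℝ))) (M : ℕ) (hM : 0 < M) :
    ∑' n, g (n + (M + 1)) ≤ 2 / √(M : ℝ) := by
  refine Real.tsum_le_of_sum_range_le (fun n => hg0 _) fun n => ?_
  have h : ∑ i ∈ Finset.range n, g (i + (M + 1)) ≤ 2 / √(M : ℝ) - 2 / √((M : ℝ) + n) := by
    induction n with
    | zero => simp
    | succ n ih =>
      rw [Finset.sum_range_succ]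
      have h1 := hg (n + (M + 1))
      rw [rpow_neg_three_halves] at h1
      have h2 := inv_sqrt_cube_le ((M : ℝ) + n) (by positivity)
      have h3 : ((n + (M + 1) : ℕ) : ℝ) = (M : ℝ) + n + 1 := by push_cast; ring
      rw [h3] at h1
      have h4 : (M : ℝ) + (n + 1 : ℕ) = (M : ℝ) + n + 1 := by push_cast; ring
      rw [h4]
      linarith
  have : 0 ≤ 2 / √((M : ℝ) + n) := by positivity
  linarith

lemma summable_rpow_neg_three_halves : Summable fun n : ℕ => (n : ℝ) ^ (-(3 / 2 : ℝ)) :=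
  Real.summable_nat_rpow.mpr (by norm_num)

lemma summable_rpow_neg_three : Summable fun n : ℕ => (n : ℝ) ^ (-(3 : ℝ)) :=
  Real.summable_nat_rpow.mpr (by norm_num)

lemma summable_ite_of_nonneg {f : ℕ → ℝ} (hf : Summable f) (h0 : ∀ n, 0 ≤ f n) (P : ℕ → Prop)
    [DecidablePred P] : Summable fun n => if P n then f n else 0 := by
  refine Summable.of_nonneg_of_le (fun n => ?_) (fun n => ?_) hf
  · split_ifs
    exacts [h0 n, le_rfl]
  · split_ifs
    exacts [le_rfl, h0 n]

lemma tsum_succ_rpow_neg_three :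
    ∑' n : ℕ, ((n : ℝ) + 1) ^ (-(3 : ℝ)) = ∑' n : ℕ, (n : ℝ) ^ (-(3 : ℝ)) := by
  rw [summable_rpow_neg_three.tsum_eq_zero_add]
  simp

lemma tsum_rpow_neg_three_pos : 0 < ∑' n : ℕ, (n : ℝ) ^ (-(3 : ℝ)) :=
  summable_rpow_neg_three.tsum_pos (fun n => by positivity) 1 (by simp)

lemma tsum_not_dvd_rpow (p : ℕ) (hp : 0 < p) :
    ∑' n : ℕ, (if ¬ p ∣ n then (n : ℝ) ^ (-(3 : ℝ)) else 0) =
      (1 - ((p : ℝ) ^ 3)⁻¹) * ∑' n : ℕ, (n : ℝ) ^ (-(3 : ℝ)) := by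
  have h0 : ∀ n : ℕ, 0 ≤ (n : ℝ) ^ (-(3 : ℝ)) := fun n => by positivity
  have h1 : ∑' n : ℕ, (if p ∣ n then (n : ℝ) ^ (-(3 : ℝ)) else 0) =
      ((p : ℝ) ^ 3)⁻¹ * ∑' n : ℕ, (n : ℝ) ^ (-(3 : ℝ)) := by
    have hinj : Function.Injective fun k : ℕ => p * k :=
      fun a b h => Nat.eq_of_mul_eq_mul_left hp h
    rw [← hinj.tsum_eq (f := fun n : ℕ => if p ∣ n then (n : ℝ) ^ (-(3 : ℝ)) else 0),
      ← tsum_mul_left]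
    · refine tsum_congr fun k => ?_
      rw [if_pos (Dvd.intro k rfl), Nat.cast_mul,
        Real.mul_rpow (Nat.cast_nonneg p) (Nat.cast_nonneg k), Real.rpow_neg (Nat.cast_nonneg p)]
      norm_cast
    · intro n hn
      by_cases hd : p ∣ n
      · obtain ⟨k, rfl⟩ := hd
        exact ⟨k, rfl⟩
      · simp [hd] at hn
  have h2 := (summable_ite_of_nonneg summable_rpow_neg_three h0 (fun n => p ∣ n)).tsum_add
    (summable_ite_of_nonneg summable_rpow_neg_three h0 (fun n => ¬ p ∣ n))
  have h3 : ∀ n : ℕ, ((if p ∣ n then (n : ℝ) ^ (-(3 : ℝ)) else 0) +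
      if ¬ p ∣ n then (n : ℝ) ^ (-(3 : ℝ)) else 0) = (n : ℝ) ^ (-(3 : ℝ)) := fun n => by
    by_cases h : p ∣ n <;> simp [h]
  rw [tsum_congr h3, h1] at h2
  linarith

variable {p : ℕ} [hp : Fact p.Prime]

open Classical in
lemma tsum_nonresidue_eq :
    ∑' n : ℕ, (if legendreSym p n = -1 then ((n : ℝ)) ^ (-(3 / 2 : ℝ)) else 0) =
      (1 - ((p : ℝ) ^ 3)⁻¹) * (∑' n : ℕ, (n : ℝ) ^ (-(3 : ℝ))) *
        ∑' b : ℕ, (if Squarefree b ∧ legendreSym p b = -1 then (b : ℝ) ^ (-(3 / 2 : ℝ)) else 0) := by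
  have h0 : ∀ n : ℕ, 0 ≤ (n : ℝ) ^ (-(3 : ℝ)) := fun n => by positivity
  have h0' : ∀ n : ℕ, 0 ≤ (n : ℝ) ^ (-(3 / 2 : ℝ)) := fun n => by positivity
  rw [← tsum_not_dvd_rpow p hp.out.pos,
    tsum_mul_tsum_of_summable_norm
      (summable_ite_of_nonneg summable_rpow_neg_three h0 _).norm
      (summable_ite_of_nonneg summable_rpow_neg_three_halves h0' _).norm]
  refine tsum_eq_tsum_of_ne_zero_bij (fun z => z.1.1 ^ 2 * z.1.2) ?_ ?_ ?_
  · rintro ⟨⟨m, b⟩, h⟩ ⟨⟨m', b'⟩, h'⟩ heq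
    simp only [Function.mem_support, ne_eq, mul_eq_zero, ite_eq_right_iff, not_or,
      Classical.not_imp] at h h' heq
    have hm : m ≠ 0 := fun h3 => h.1.1 (by simp [h3])
    have hm' : m' ≠ 0 := fun h3 => h'.1.1 (by simp [h3])
    have hbb := squarefree_eq_of_sq_mul_eq h.2.1.1 h'.2.1.1 hm hm' heq
    subst hbb
    have h1 := Nat.eq_of_mul_eq_mul_right (Nat.pos_of_ne_zero h.2.1.1.ne_zero) heq
    have h2 : m = m' := Nat.pow_left_injective (n := 2) (by norm_num) h1
    simp [h2]
  · intro n hn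
    simp only [Function.mem_support, ne_eq, ite_eq_right_iff, Classical.not_imp] at hn
    obtain ⟨b, m, hbm, hb⟩ := Nat.sq_mul_squarefree n
    have hm : ¬ p ∣ m := by
      intro h
      have h1 : legendreSym p (n : ℤ) = 0 := by
        rw [legendreSym.eq_zero_iff]
        push_cast
        rw [ZMod.natCast_eq_zero_iff, ← hbm]
        exact (dvd_pow h two_ne_zero).trans (Dvd.intro _ rfl)
      rw [h1] at hn
      norm_num at hn
    have hm0 : (m : ℝ) ≠ 0 := by
      intro h
      exact hm (by simp [Nat.cast_eq_zero.mp h])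
    have hb0 : (b : ℝ) ≠ 0 := by exact_mod_cast hb.ne_zero
    have hl : legendreSym p (b : ℤ) = -1 := by
      rw [← hn.1, ← hbm]
      push_cast
      rw [legendreSym.mul, legendreSym.sq_one', one_mul]
      push_cast
      rwa [Ne, ZMod.natCast_eq_zero_iff]
    refine ⟨⟨(m, b), ?_⟩, hbm⟩
    simp only [Function.mem_support]
    rw [if_pos hm, if_pos ⟨hb, hl⟩]
    positivity
  · rintro ⟨⟨m, b⟩, h⟩
    simp only [Function.mem_support, ne_eq, mul_eq_zero, ite_eq_right_iff, not_or,
      Classical.not_imp] at h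
    have hl : legendreSym p ((m ^ 2 * b : ℕ) : ℤ) = -1 := by
      rw [← h.2.1.2]
      push_cast
      rw [legendreSym.mul, legendreSym.sq_one', one_mul]
      push_cast
      rw [Ne, ZMod.natCast_eq_zero_iff]
      exact h.1.1
    simp only
    rw [if_pos hl, if_pos h.1.1, if_pos h.2.1]
    push_cast
    rw [Real.mul_rpow (by positivity) (by positivity), ← Real.rpow_natCast, ← Real.rpow_mul
      (by positivity)]
    norm_num

end MainTerm

section Assembly

lemma abs_card_not_dvd_sub_le {p : ℕ} (hp0 : 0 < p) (y : ℝ) (hy : 0 ≤ y) :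
    |(((Finset.Ioc 0 ⌊y⌋₊).filter fun a => ¬ p ∣ a).card : ℝ) - (1 - (p : ℝ)⁻¹) * y| ≤ 1 := by
  have h1 := Finset.card_filter_add_card_filter_not (s := Finset.Ioc 0 ⌊y⌋₊) (fun a => p ∣ a)
  rw [Nat.Ioc_filter_dvd_card_eq_div, Nat.card_Ioc, Nat.sub_zero] at h1
  have h2 : ((⌊y⌋₊ / p : ℕ) : ℝ) + (((Finset.Ioc 0 ⌊y⌋₊).filter fun a => ¬ p ∣ a).card : ℝ) =
      ⌊y⌋₊ := by exact_mod_cast h1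
  have hpR : (0 : ℝ) < p := by exact_mod_cast hp0
  have h3 : ((⌊y⌋₊ / p : ℕ) : ℝ) ≤ (⌊y⌋₊ : ℝ) * (p : ℝ)⁻¹ := by
    rw [← div_eq_mul_inv]; exact Nat.cast_div_le
  have h4 : y * (p : ℝ)⁻¹ < ((⌊y⌋₊ / p : ℕ) : ℝ) + 1 := by
    rw [← Nat.floor_div_natCast, ← div_eq_mul_inv]
    exact Nat.lt_floor_add_one _
  have h5 := Nat.floor_le hy
  have h6 := Nat.lt_floor_add_one y
  have h7 : (p : ℝ)⁻¹ ≤ 1 := inv_le_one_of_one_le₀ (by exact_mod_cast hp0)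
  have h8 : 0 < (p : ℝ)⁻¹ := by positivity
  rw [abs_le]
  constructor <;> nlinarith

variable {p : ℕ} [hp : Fact p.Prime]

open Classical in
lemma abs_main_sum_sub_le (x X : ℝ) (hx : 2 ≤ x) (hX0 : 0 ≤ X) (hX : X ^ 3 = x) :
    |∑ b ∈ Finset.Ioc 0 ⌊X⌋₊ with Squarefree b ∧ legendreSym p ((b : ℕ) : ℤ) = -1,
        (((Finset.Ioc 0 (sqBound x b)).filter fun a => ¬ p ∣ a).card : ℝ) -
      (1 - (p : ℝ)⁻¹) * √x * ∑' b : ℕ,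
        (if Squarefree b ∧ legendreSym p b = -1 then (b : ℝ) ^ (-(3 / 2 : ℝ)) else 0)| ≤
      4 * X := by
  have hX1 : 1 ≤ X := by
    by_contra h
    push Not at h
    have : X ^ 3 ≤ 1 := pow_le_one₀ hX0 h.le
    linarith
  set g : ℕ → ℝ := fun b =>
    if Squarefree b ∧ legendreSym p b = -1 then (b : ℝ) ^ (-(3 / 2 : ℝ)) else 0 with hg
  set M := ⌊X⌋₊
  set S := (Finset.Ioc 0 M).filter fun b : ℕ => Squarefree b ∧ legendreSym p (b : ℤ) = -1 with hS
  have hM : 0 < M := Nat.floor_pos.mpr hX1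
  have hg0 : ∀ n, 0 ≤ g n := fun n => by
    simp only [hg]; split_ifs <;> positivity
  have hgle : ∀ n : ℕ, g n ≤ (n : ℝ) ^ (-(3 / 2 : ℝ)) := fun n => by
    simp only [hg]; split_ifs
    · exact le_rfl
    · positivity
  have hsum : Summable g := Summable.of_nonneg_of_le hg0 hgle summable_rpow_neg_three_halves
  have hpI : 0 ≤ 1 - (p : ℝ)⁻¹ ∧ 1 - (p : ℝ)⁻¹ ≤ 1 := by
    have h1 : (p : ℝ)⁻¹ ≤ 1 := inv_le_one_of_one_le₀ (by exact_mod_cast hp.out.pos)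
    have h2 : (0 : ℝ) ≤ (p : ℝ)⁻¹ := by positivity
    constructor <;> linarith
  have hsplit : ∑' b, g b = ∑ b ∈ S, g b + ∑' n, g (n + (M + 1)) := by
    rw [← hsum.sum_add_tsum_nat_add (M + 1)]
    congr 1
    have h1 : Finset.Ioc 0 M = (Finset.range (M + 1)).erase 0 := by ext; simp; omega
    rw [hS, Finset.sum_filter, h1, ← Finset.sum_erase (a := 0)]
    · refine Finset.sum_congr rfl fun b _ => ?_
      simp only [hg]
      split_ifs <;> rfl
    · simp [hg]
  have htail : √x * ∑' n, g (n + (M + 1)) ≤ 3 * X := by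
    have h1 := tsum_tail_le g hg0 hgle M hM
    have h2 : X ≤ 2 * M := by
      have := Nat.lt_floor_add_one X
      have h3 : (1 : ℝ) ≤ M := by exact_mod_cast hM
      linarith
    have h3 : √x = X * √X := by
      rw [← hX, show X ^ 3 = X ^ 2 * X by ring, Real.sqrt_mul (by positivity), Real.sqrt_sq hX0]
    have hM0 : (0 : ℝ) < √(M : ℝ) := Real.sqrt_pos.mpr (by exact_mod_cast hM)
    have h4 : √X ≤ 1.5 * √(M : ℝ) := by
      rw [Real.sqrt_le_left (by positivity), mul_pow, Real.sq_sqrt (Nat.cast_nonneg M)]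
      linarith
    calc _ ≤ √x * (2 / √(M : ℝ)) := by gcongr
      _ = X * (2 * √X / √(M : ℝ)) := by rw [h3]; ring
      _ ≤ X * 3 := by
        gcongr
        rw [div_le_iff₀ hM0]
        linarith
      _ = _ := by ring
  have htail0 : 0 ≤ √x * ∑' n, g (n + (M + 1)) :=
    mul_nonneg (Real.sqrt_nonneg _) (tsum_nonneg fun n => hg0 _)
  have hfin : |∑ b ∈ S, (((Finset.Ioc 0 (sqBound x b)).filter fun a => ¬ p ∣ a).card : ℝ) -
      (1 - (p : ℝ)⁻¹) * √x * ∑ b ∈ S, g b| ≤ X := by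
    rw [Finset.mul_sum, ← Finset.sum_sub_distrib]
    refine (Finset.abs_sum_le_sum_abs _ _).trans ?_
    calc _ ≤ ∑ b ∈ S, (1 : ℝ) := by
          refine Finset.sum_le_sum fun b hb => ?_
          have h1 := abs_card_not_dvd_sub_le (p := p) hp.out.pos (√(x / (b : ℝ) ^ 3))
            (Real.sqrt_nonneg _)
          have h2 : √(x / (b : ℝ) ^ 3) = √x * g b := by
            simp only [hg]
            rw [if_pos (Finset.mem_filter.mp hb).2, rpow_neg_three_halves, ← div_eq_mul_inv,
              Real.sqrt_div (by linarith)]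
            congr 1
            rw [show (b : ℝ) ^ 3 = (b : ℝ) ^ 2 * b by ring, Real.sqrt_mul (by positivity),
              Real.sqrt_sq (by positivity), pow_succ (√(b : ℝ)), Real.sq_sqrt (by positivity)]
          rw [mul_assoc, ← h2]
          exact h1
      _ = S.card := by simp
      _ ≤ M := by
          have := Finset.card_filter_le (Finset.Ioc 0 M)
            fun b : ℕ => Squarefree b ∧ legendreSym p (b : ℤ) = -1
          rw [Nat.card_Ioc, Nat.sub_zero] at this
          exact_mod_cast this
      _ ≤ X := Nat.floor_le hX0
  rw [hsplit, mul_add]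
  rw [abs_le] at hfin ⊢
  have h1 : (1 - (p : ℝ)⁻¹) * √x * ∑' n, g (n + (M + 1)) ≤ 3 * X := by
    rw [mul_assoc]
    exact (mul_le_of_le_one_left htail0 hpI.2).trans htail
  have h2 : 0 ≤ (1 - (p : ℝ)⁻¹) * √x * ∑' n, g (n + (M + 1)) := by
    rw [mul_assoc]
    exact mul_nonneg hpI.1 htail0
  constructor <;> linarith

end Assembly

end SquarefullPrimitiveRoots

open SquarefullPrimitiveRoots

open Classical in
/-- Theorem 1: asymptotic count of square-full primitive roots mod `p` up to `x`,
with main term `(φ(p-1)/(p-1)) ζ(3)⁻¹ (1 + 1/p + 1/p²)⁻¹ C_p x^(1/2)` where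
`C_p = 2 ∑_{(n|p) = -1} n^(-3/2)`, and error term
`O(x^(1/3) (log x) p^(1/9) (log p)^(1/6) 2^(ω(p-1)))`. -/
theorem squarefull_primitive_root_count_asymptotic :
    ∃ C : ℝ, 0 < C ∧ ∀ (p : ℕ) [Fact p.Prime], Odd p → ∀ x : ℝ, 2 ≤ x →
      |(((Finset.Icc 1 ⌊x⌋₊).filter
            (fun m => Squarefull m ∧ orderOf (m : ZMod p) = p - 1)).card : ℝ)
          - ((Nat.totient (p - 1) : ℝ) / ((p : ℝ) - 1))
            * (∑' n : ℕ, ((n : ℝ) + 1) ^ (-(3 : ℝ)))⁻¹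
            * (1 + 1 / (p : ℝ) + 1 / (p : ℝ) ^ 2)⁻¹
            * (2 * ∑' n : ℕ, if legendreSym p n = -1 then ((n : ℝ)) ^ (-(3/2 : ℝ)) else 0)
            * x ^ ((1 : ℝ)/2)|
        ≤ C * ((Nat.totient (p - 1) : ℝ) / ((p : ℝ) - 1)) * x ^ ((1 : ℝ)/3) * Real.log x
            * (p : ℝ) ^ ((1 : ℝ)/9) * (Real.log p) ^ ((1 : ℝ)/6)
            * 2 ^ (p - 1).primeFactors.card := by
  refine ⟨136, by norm_num, fun p hp hodd x hx => ?_⟩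
  have hp3 : 3 ≤ p := by
    have h1 := hp.out.two_le
    have h2 : p ≠ 2 := by rintro rfl; exact absurd hodd (by decide)
    omega
  have hpR : (3 : ℝ) ≤ p := by exact_mod_cast hp3
  have hρ : (Nat.totient (p - 1) : ℝ) / ((p : ℝ) - 1) = density (p - 1) := by
    rw [← density_eq (p - 1) (by omega), Nat.cast_sub (by omega), Nat.cast_one]
  rw [hρ]
  set X : ℝ := x ^ ((1 : ℝ) / 3) with hXdef
  have hX0 : 0 ≤ X := by positivity
  have hX : X ^ 3 = x := by
    rw [hXdef, ← Real.rpow_natCast, ← Real.rpow_mul (by linarith)]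
    norm_num
  have h1 := abs_card_sub_le (p := p) hp3 x X hx hX0 hX
  have h2 := abs_main_sum_sub_le (p := p) x X hx hX0 hX
  have hZ := tsum_rpow_neg_three_pos
  rw [tsum_succ_rpow_neg_three, tsum_nonresidue_eq, ← Real.sqrt_eq_rpow]
  set Z := ∑' n : ℕ, (n : ℝ) ^ (-(3 : ℝ))
  set B := ∑' b : ℕ, (if Squarefree b ∧ legendreSym p b = -1 then (b : ℝ) ^ (-(3 / 2 : ℝ)) else 0)
  set S := ∑ b ∈ Finset.Ioc 0 ⌊X⌋₊ with Squarefree b ∧ legendreSym p ((b : ℕ) : ℤ) = -1,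
        (((Finset.Ioc 0 (sqBound x b)).filter fun a => ¬ p ∣ a).card : ℝ)
  set ρ := density (p - 1) with hρdef
  have hρ0 : 0 ≤ ρ := density_nonneg _
  have hmain : ρ * Z⁻¹ * (1 + 1 / (p : ℝ) + 1 / (p : ℝ) ^ 2)⁻¹ *
      (2 * ((1 - ((p : ℝ) ^ 3)⁻¹) * Z * B)) * √x = 2 * ρ * ((1 - (p : ℝ)⁻¹) * √x * B) := by
    have hp0 : (p : ℝ) ≠ 0 := by positivity
    have h3 : 1 - ((p : ℝ) ^ 3)⁻¹ =
        (1 + 1 / (p : ℝ) + 1 / (p : ℝ) ^ 2) * (1 - (p : ℝ)⁻¹) := by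
      field_simp
      ring
    have h4 : (1 + 1 / (p : ℝ) + 1 / (p : ℝ) ^ 2) ≠ 0 := by positivity
    rw [h3]
    generalize 1 + 1 / (p : ℝ) + 1 / (p : ℝ) ^ 2 = K at h4 ⊢
    generalize 1 - (p : ℝ)⁻¹ = k
    field_simp
  rw [hmain]
  set N : ℝ := (((Finset.Icc 1 ⌊x⌋₊).filter
            (fun m => Squarefull m ∧ orderOf (m : ZMod p) = p - 1)).card : ℝ)
  have hlp : 1 ≤ Real.log p := one_le_log_of_three_le hp3
  have hlx := one_le_log_mul hx
  have hP : (1 : ℝ) ≤ (p : ℝ) ^ (1 / 9 : ℝ) := Real.one_le_rpow (by linarith) (by norm_num)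
  have hl : (1 : ℝ) ≤ Real.log p ^ (1 / 6 : ℝ) := Real.one_le_rpow hlp (by norm_num)
  have hω : (1 : ℝ) ≤ 2 ^ (p - 1).primeFactors.card := one_le_pow₀ (by norm_num)
  set P := (p : ℝ) ^ (1 / 9 : ℝ)
  set l := Real.log p ^ (1 / 6 : ℝ)
  set w : ℝ := 2 ^ (p - 1).primeFactors.card
  have h5 : |2 * ρ * S - 2 * ρ * ((1 - (p : ℝ)⁻¹) * √x * B)| ≤ 8 * (ρ * X) := by
    rw [← mul_sub, abs_mul, abs_of_nonneg (by positivity)]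
    calc _ ≤ 2 * ρ * (4 * X) := by gcongr
      _ = _ := by ring
  have h6 : ρ * X ≤ ρ * X * (1.5 * Real.log x * P * l * w) := by
    refine le_mul_of_one_le_right (by positivity) ?_
    exact one_le_mul_of_one_le_of_one_le (one_le_mul_of_one_le_of_one_le
      (one_le_mul_of_one_le_of_one_le hlx hP) hl) hω
  calc _ ≤ |N - 2 * ρ * S| + |2 * ρ * S - 2 * ρ * ((1 - (p : ℝ)⁻¹) * √x * B)| :=
        abs_sub_le _ _ _
    _ ≤ ρ * w * (2 * (62 * X * Real.log x * (P * l))) +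
        8 * (ρ * X * (1.5 * Real.log x * P * l * w)) := by linarith
    _ = _ := by ring
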